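/- arXiv:1503.08941 — 2 statements merged into one kernel-verified Lean document; each statement's English description precedes it below -/
import Mathlib

section
/- Let G be a connected graph on n vertices with minimum degree δ ≥ 3. Then mvc(G) ≥ n/4 + 3. -/
open SimpleGraph

/-- A vertex-coloring `c` of `G` is an MVC-coloring if any two vertices are joined by a
path whose internal vertices all have the same color. -/
def IsMVCColoring {V : Type*} (G : SimpleGraph V) (c : V → ℕ) : Prop :=
  ∀ u v : V, ∃ p : G.Walk u v, p.IsPath ∧
    ∀ x ∈ p.support.tail.dropLast, ∀ y ∈ p.support.tail.dropLast, c x = c y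

/-- The monochromatic vertex-connection number: the maximum number of colors
used in an MVC-coloring of `G`. -/
noncomputable def mvc {V : Type*} (G : SimpleGraph V) : ℕ :=
  sSup {k : ℕ | ∃ c : V → ℕ, IsMVCColoring G c ∧ (Set.range c).ncard = k}

namespace SimpleGraph

variable {V : Type*}

/-- Any two vertices of `I` are joined by a walk inside `I`. -/
def WalkConnectedOn (G : SimpleGraph V) (I : Finset V) : Prop :=
  ∀ a ∈ I, ∀ b ∈ I, ∃ p : G.Walk a b, ∀ x ∈ p.support, x ∈ I

lemma walkConnectedOn_singleton {G : SimpleGraph V} (v : V) : G.WalkConnectedOn {v} := by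
  intro a ha b hb
  obtain rfl := Finset.mem_singleton.1 ha
  obtain rfl := Finset.mem_singleton.1 hb
  exact ⟨Walk.nil, by simp⟩

section Growth

variable [Fintype V] [DecidableEq V] (G : SimpleGraph V) [DecidableRel G.Adj]

/-- The vertices of `I` together with all their neighbors. -/
def closedNbhd (I : Finset V) : Finset V :=
  Finset.univ.filter fun v => v ∈ I ∨ ∃ u ∈ I, G.Adj u v

/-- The vertices outside `I` with a neighbor in `I`: the leaves of a tree with interior `I`. -/
def outerBoundary (I : Finset V) : Finset V := G.closedNbhd I \ I

/-- The neighbors of `y` outside the closed neighborhood of `I`. -/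
def newNbrs (I : Finset V) (y : V) : Finset V := G.neighborFinset y \ G.closedNbhd I

/-- The boundary vertices without neighbors outside the closed neighborhood of `I`. -/
def deadLeaves (I : Finset V) : Finset V :=
  (G.outerBoundary I).filter fun v => ∀ w, G.Adj v w → w ∈ G.closedNbhd I

/-- The Kleitman–West potential `3 * leaves + dead leaves - vertices` of a tree with interior `I`
spanning the closed neighborhood of `I`. -/
def leafPotential (I : Finset V) : ℤ :=
  2 * (G.outerBoundary I).card + (G.deadLeaves I).card - I.card

variable {G} {I : Finset V} {v x y : V}

lemma mem_closedNbhd : v ∈ G.closedNbhd I ↔ v ∈ I ∨ ∃ u ∈ I, G.Adj u v := by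
  simp [closedNbhd]

lemma mem_outerBoundary : v ∈ G.outerBoundary I ↔ v ∉ I ∧ ∃ u ∈ I, G.Adj u v := by
  simp only [outerBoundary, Finset.mem_sdiff, mem_closedNbhd]
  tauto

lemma mem_newNbrs : v ∈ G.newNbrs I y ↔ G.Adj y v ∧ v ∉ G.closedNbhd I := by
  simp [newNbrs]

lemma mem_deadLeaves :
    v ∈ G.deadLeaves I ↔ v ∈ G.outerBoundary I ∧ ∀ w, G.Adj v w → w ∈ G.closedNbhd I := by
  simp [deadLeaves]

lemma closedNbhd_insert (hy : y ∈ G.outerBoundary I) :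
    G.closedNbhd (insert y I) = G.closedNbhd I ∪ G.newNbrs I y := by
  ext v
  simp only [mem_outerBoundary, mem_closedNbhd, mem_newNbrs, Finset.mem_union,
    Finset.mem_insert] at *
  grind

lemma outerBoundary_insert (hy : y ∈ G.outerBoundary I) :
    G.outerBoundary (insert y I) = (G.outerBoundary I).erase y ∪ G.newNbrs I y := by
  ext v
  simp only [mem_outerBoundary, mem_newNbrs, mem_closedNbhd, Finset.mem_union,
    Finset.mem_insert, Finset.mem_erase] at *
  grind [SimpleGraph.irrefl]

lemma card_outerBoundary_insert (hy : y ∈ G.outerBoundary I) :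
    (G.outerBoundary (insert y I)).card + 1 =
      (G.outerBoundary I).card + (G.newNbrs I y).card := by
  rw [outerBoundary_insert hy, Finset.card_union_of_disjoint, ← Finset.card_erase_add_one hy]
  · omega
  · rw [Finset.disjoint_left]
    intro v hv hv'
    exact (mem_newNbrs.1 hv').2
      (Finset.mem_sdiff.1 (show v ∈ G.closedNbhd I \ I from Finset.mem_of_mem_erase hv)).1

lemma card_insert_of_mem_outerBoundary (hy : y ∈ G.outerBoundary I) :
    (insert y I).card = I.card + 1 :=
  Finset.card_insert_of_notMem (mem_outerBoundary.1 hy).1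

lemma notMem_deadLeaves_of_mem_newNbrs (hx : x ∈ G.newNbrs I y) : y ∉ G.deadLeaves I :=
  fun h => (mem_newNbrs.1 hx).2 ((mem_deadLeaves.1 h).2 x (mem_newNbrs.1 hx).1)

lemma deadLeaves_subset_insert (hy : y ∈ G.outerBoundary I) (hx : x ∈ G.newNbrs I y) :
    G.deadLeaves I ⊆ G.deadLeaves (insert y I) := by
  intro v hv
  have hvy : v ≠ y := fun h => notMem_deadLeaves_of_mem_newNbrs hx (h ▸ hv)
  rw [mem_deadLeaves] at hv ⊢
  rw [outerBoundary_insert hy, closedNbhd_insert hy]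
  exact ⟨Finset.mem_union_left _ (Finset.mem_erase.2 ⟨hvy, hv.1⟩),
    fun w hw => Finset.mem_union_left _ (hv.2 w hw)⟩

lemma card_deadLeaves_lt (hy : y ∈ G.outerBoundary I) (hx : x ∈ G.newNbrs I y) :
    (G.deadLeaves I).card < (G.outerBoundary I).card :=
  Finset.card_lt_card <| Finset.ssubset_iff_subset_ne.2
    ⟨Finset.filter_subset _ _, fun h => notMem_deadLeaves_of_mem_newNbrs hx (h ▸ hy)⟩

lemma deadLeaves_eq_outerBoundary (h : G.closedNbhd I = Finset.univ) :
    G.deadLeaves I = G.outerBoundary I := by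
  ext v
  simp [mem_deadLeaves, h]

lemma card_outerBoundary_add (h : G.closedNbhd I = Finset.univ) :
    (G.outerBoundary I).card + I.card = Fintype.card V := by
  rw [outerBoundary, h, Finset.card_sdiff_add_card_eq_card (Finset.subset_univ I),
    Finset.card_univ]

lemma WalkConnectedOn.insert (hI : G.WalkConnectedOn I) (hy : y ∈ G.outerBoundary I) :
    G.WalkConnectedOn (insert y I) := by
  obtain ⟨-, z, hz, hzy⟩ := mem_outerBoundary.1 hy
  intro a ha b hb
  rcases Finset.mem_insert.1 ha with rfl | ha' <;>
    rcases Finset.mem_insert.1 hb with rfl | hb'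
  · exact ⟨Walk.nil, by simp⟩
  · obtain ⟨p, hp⟩ := hI z hz b hb'
    exact ⟨Walk.cons hzy.symm p, by simp; grind⟩
  · obtain ⟨p, hp⟩ := hI a ha' z hz
    exact ⟨p.concat hzy, by simp [Walk.support_concat]; grind⟩
  · obtain ⟨p, hp⟩ := hI a ha' b hb'
    exact ⟨p, fun x hx => Finset.mem_insert_of_mem (hp x hx)⟩

/-- A connected graph with a non-dominating nonempty set `I` has an edge leaving the closed
neighborhood of `I`. -/
lemma exists_newNbr (hG : G.Connected) (hI : I.Nonempty) (h : G.closedNbhd I ≠ Finset.univ) :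
    ∃ y ∈ G.outerBoundary I, ∃ x, x ∈ G.newNbrs I y := by
  obtain ⟨w, hw⟩ : ∃ w, w ∉ G.closedNbhd I := by
    by_contra! hc
    exact h (Finset.eq_univ_of_forall hc)
  obtain ⟨a, ha⟩ := hI
  obtain ⟨p⟩ := hG.preconnected a w
  obtain ⟨d, -, hd, hd'⟩ := p.exists_boundary_dart (G.closedNbhd I : Set V)
    (mem_closedNbhd.2 (Or.inl ha)) hw
  refine ⟨d.fst, Finset.mem_sdiff.2 ⟨hd, fun hdI => hd' ?_⟩, d.snd, mem_newNbrs.2 ⟨d.adj, hd'⟩⟩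
  exact mem_closedNbhd.2 (Or.inr ⟨_, hdI, d.adj⟩)

/-- A non-dominating connected set can be enlarged without decreasing the potential, and the last
enlargement gains at least two. -/
lemma exists_leafPotential_le (hG : G.Connected) (hδ : ∀ v, 3 ≤ G.degree v) (hI : I.Nonempty)
    (hconn : G.WalkConnectedOn I) (h : G.closedNbhd I ≠ Finset.univ) :
    ∃ J, G.WalkConnectedOn J ∧ I ⊂ J ∧ G.leafPotential I ≤ G.leafPotential J ∧
      (G.closedNbhd J = Finset.univ → G.leafPotential I + 2 ≤ G.leafPotential J) := by
  by_cases hbig : ∃ y ∈ G.outerBoundary I, 2 ≤ (G.newNbrs I y).card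
  · obtain ⟨y, hy, hcard⟩ := hbig
    obtain ⟨x, hx⟩ := Finset.card_pos.1 (by omega : 0 < (G.newNbrs I y).card)
    have hb := card_outerBoundary_insert hy
    have hi := card_insert_of_mem_outerBoundary hy
    have hd := Finset.card_le_card (deadLeaves_subset_insert hy hx)
    have hlt := card_deadLeaves_lt hy hx
    refine ⟨insert y I, hconn.insert hy, Finset.ssubset_insert (mem_outerBoundary.1 hy).1, ?_,
      fun hdom => ?_⟩
    · unfold leafPotential
      omega
    · have := congrArg Finset.card (deadLeaves_eq_outerBoundary hdom)
      unfold leafPotential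
      omega
  push Not at hbig
  obtain ⟨y, hy, x, hx⟩ := exists_newNbr hG hI h
  have hone : ∀ z ∈ G.outerBoundary I, x ∈ G.newNbrs I z → G.newNbrs I z = {x} := by
    intro z hz hxz
    have := hbig z hz
    exact (Finset.card_eq_one.1 (by
      have := Finset.card_pos.2 ⟨x, hxz⟩
      omega : (G.newNbrs I z).card = 1)).elim fun a ha => by
        rw [ha] at hxz ⊢
        rw [Finset.mem_singleton.1 hxz]
  have hyx := hone y hy hx
  have hxadj := (mem_newNbrs.1 hx).1
  have hxN := (mem_newNbrs.1 hx).2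
  have hnbr : ∀ z ∈ G.closedNbhd I, G.Adj x z → z ∈ G.outerBoundary I := fun z hz hxz =>
    Finset.mem_sdiff.2 ⟨hz, fun hzI => hxN (mem_closedNbhd.2 (Or.inr ⟨z, hzI, hxz.symm⟩))⟩
  have hb := card_outerBoundary_insert hy
  have hi := card_insert_of_mem_outerBoundary hy
  have hsub := deadLeaves_subset_insert hy hx
  have hN := closedNbhd_insert hy
  have hB := outerBoundary_insert hy
  have hlt := card_deadLeaves_lt hy hx
  have hdegx := hδ x
  rw [hyx] at hb hN hB
  rw [Finset.card_singleton] at hb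
  by_cases htwo : ∃ z ∈ G.outerBoundary I, z ≠ y ∧ G.Adj x z
  · obtain ⟨z, hz, hzy, hxz⟩ := htwo
    have hzx : x ∈ G.newNbrs I z := mem_newNbrs.2 ⟨hxz.symm, hxN⟩
    refine ⟨insert y I, hconn.insert hy, Finset.ssubset_insert (mem_outerBoundary.1 hy).1, ?_,
      fun hdom => ?_⟩
    · have hzdead : z ∈ G.deadLeaves (insert y I) := by
        rw [mem_deadLeaves, hB, hN]
        refine ⟨Finset.mem_union_left _ (Finset.mem_erase.2 ⟨hzy, hz⟩), fun w hw => ?_⟩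
        by_cases hwN : w ∈ G.closedNbhd I
        · exact Finset.mem_union_left _ hwN
        · exact Finset.mem_union_right _ (hone z hz hzx ▸ mem_newNbrs.2 ⟨hw, hwN⟩)
      have : (G.deadLeaves I).card < (G.deadLeaves (insert y I)).card :=
        Finset.card_lt_card <| Finset.ssubset_iff_subset_ne.2
          ⟨hsub, fun he => notMem_deadLeaves_of_mem_newNbrs hzx (he ▸ hzdead)⟩
      unfold leafPotential
      omega
    · have hall : G.neighborFinset x ⊆ G.outerBoundary I \ G.deadLeaves I := by
        intro u hu
        rw [mem_neighborFinset] at hu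
        have huN : u ∈ G.closedNbhd (insert y I) := hdom ▸ Finset.mem_univ u
        rw [hN, Finset.mem_union, Finset.mem_singleton] at huN
        exact Finset.mem_sdiff.2 ⟨hnbr u (huN.resolve_right hu.ne') hu,
          notMem_deadLeaves_of_mem_newNbrs (mem_newNbrs.2 ⟨hu.symm, hxN⟩)⟩
      have hle := Finset.card_le_card hall
      have hadd := Finset.card_sdiff_add_card_eq_card
        (show G.deadLeaves I ⊆ G.outerBoundary I from Finset.filter_subset _ _)
      rw [card_neighborFinset_eq_degree] at hle
      have := congrArg Finset.card (deadLeaves_eq_outerBoundary hdom)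
      unfold leafPotential
      omega
  · push Not at htwo
    have hxB : x ∈ G.outerBoundary (insert y I) := by
      rw [hB]
      exact Finset.mem_union_right _ (Finset.mem_singleton_self x)
    have hnew : (G.neighborFinset x).erase y ⊆ G.newNbrs (insert y I) x := by
      intro u hu
      rw [Finset.mem_erase, mem_neighborFinset] at hu
      rw [mem_newNbrs, hN, Finset.mem_union, Finset.mem_singleton]
      refine ⟨hu.2, ?_⟩
      rintro (huN | rfl)
      · exact htwo u (hnbr u huN hu.2) hu.1 hu.2
      · exact hu.2.ne rfl
    have hcard := Finset.card_le_card hnew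
    rw [Finset.card_erase_of_mem (by simpa using hxadj.symm), card_neighborFinset_eq_degree]
      at hcard
    obtain ⟨t, ht⟩ := Finset.card_pos.1 (by omega : 0 < (G.newNbrs (insert y I) x).card)
    have hb' := card_outerBoundary_insert hxB
    have hi' := card_insert_of_mem_outerBoundary hxB
    have hd := Finset.card_le_card (hsub.trans (deadLeaves_subset_insert hxB ht))
    refine ⟨insert x (insert y I), (hconn.insert hy).insert hxB,
      (Finset.ssubset_insert (mem_outerBoundary.1 hy).1).trans
        (Finset.ssubset_insert (mem_outerBoundary.1 hxB).1), ?_, fun hdom => ?_⟩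
    · unfold leafPotential
      omega
    · have := congrArg Finset.card (deadLeaves_eq_outerBoundary hdom)
      unfold leafPotential
      omega

lemma exists_dominating_of_leafPotential (hG : G.Connected) (hδ : ∀ v, 3 ≤ G.degree v)
    (hI : I.Nonempty) (hconn : G.WalkConnectedOn I) (h6 : 6 ≤ G.leafPotential I)
    (h8 : G.closedNbhd I = Finset.univ → 8 ≤ G.leafPotential I) :
    ∃ J : Finset V, J.Nonempty ∧ G.WalkConnectedOn J ∧ G.closedNbhd J = Finset.univ ∧
      8 ≤ G.leafPotential J := by
  induction hn : Fintype.card V - I.card using Nat.strong_induction_on generalizing I with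
  | _ n ih =>
    by_cases h : G.closedNbhd I = Finset.univ
    · exact ⟨I, hI, hconn, h, h8 h⟩
    · obtain ⟨J, hJ, hIJ, hle, hdom⟩ := exists_leafPotential_le hG hδ hI hconn h
      have hlt := Finset.card_lt_card hIJ
      have := Finset.card_le_univ J
      exact ih (Fintype.card V - J.card) (by omega) (hI.mono hIJ.subset) hJ (h6.trans hle)
        (fun hd => by have := hdom hd; omega) rfl

lemma outerBoundary_singleton (v : V) : G.outerBoundary {v} = G.neighborFinset v := by
  ext w
  simp only [mem_outerBoundary, Finset.mem_singleton, exists_eq_left, mem_neighborFinset]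
  exact ⟨fun h => h.2, fun h => ⟨h.ne', h⟩⟩

/-- In a graph of degree three at `v`, if every edge at `v` lies in a triangle, then some neighbor
of `v` is adjacent to the other two. -/
lemma exists_adj_of_triangles (hv : G.degree v = 3)
    (htri : ∀ u, G.Adj v u → ∃ w, G.Adj v w ∧ G.Adj u w) :
    ∃ b, G.Adj v b ∧ ∀ w, G.Adj v w → w ≠ b → G.Adj b w := by
  rw [← card_neighborFinset_eq_degree, Finset.card_eq_three] at hv
  obtain ⟨a, b, c, hab, hac, hbc, hN⟩ := hv
  have hmem : ∀ w, G.Adj v w ↔ w = a ∨ w = b ∨ w = c := fun w => by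
    rw [← mem_neighborFinset, hN]
    simp
  simp only [hmem] at htri ⊢
  have ha : G.Adj a b ∨ G.Adj a c := by simpa using htri a (by simp)
  have hb : G.Adj b a ∨ G.Adj b c := by simpa using htri b (by simp)
  have hc : G.Adj c a ∨ G.Adj c b := by simpa using htri c (by simp)
  have hchoice : (G.Adj a b ∧ G.Adj a c) ∨ (G.Adj b a ∧ G.Adj b c) ∨
      (G.Adj c a ∧ G.Adj c b) := by
    rw [G.adj_comm b a] at *
    rw [G.adj_comm c a, G.adj_comm c b] at *
    tauto
  rcases hchoice with h | h | h
  · exact ⟨a, by simp, by grind⟩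
  · exact ⟨b, by simp, by grind⟩
  · exact ⟨c, by simp, by grind⟩

lemma exists_initial_leafPotential (hG : G.Connected) (hδ : ∀ v, 3 ≤ G.degree v) :
    ∃ I : Finset V, I.Nonempty ∧ G.WalkConnectedOn I ∧ 6 ≤ G.leafPotential I ∧
      (G.closedNbhd I = Finset.univ → 8 ≤ G.leafPotential I) := by
  have hstar : ∀ v, (G.outerBoundary {v}).card = G.degree v := fun v => by
    rw [outerBoundary_singleton, card_neighborFinset_eq_degree]
  have hdom : ∀ v, G.closedNbhd {v} = Finset.univ → 8 ≤ G.leafPotential {v} := fun v h => by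
    have := congrArg Finset.card (deadLeaves_eq_outerBoundary h)
    have := hstar v
    have := hδ v
    have := Finset.card_singleton v
    unfold leafPotential
    omega
  by_cases hfour : ∃ v, 4 ≤ G.degree v
  · obtain ⟨v, hv⟩ := hfour
    refine ⟨{v}, Finset.singleton_nonempty v, walkConnectedOn_singleton v, ?_, hdom v⟩
    have := hstar v
    have := Finset.card_singleton v
    unfold leafPotential
    omega
  push Not at hfour
  have hthree : ∀ v, G.degree v = 3 := fun v => by
    have := hδ v
    have := hfour v
    omega
  obtain ⟨v⟩ := hG.nonempty
  by_cases htri : ∀ u, G.Adj v u → ∃ w, G.Adj v w ∧ G.Adj u w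
  · obtain ⟨b, hvb, hb⟩ := exists_adj_of_triangles (hthree v) htri
    have hsub : insert v ((G.neighborFinset v).erase b) ⊆ G.neighborFinset b := by
      intro w hw
      rw [Finset.mem_insert, Finset.mem_erase, mem_neighborFinset] at hw
      rw [mem_neighborFinset]
      rcases hw with rfl | hw
      · exact hvb.symm
      · exact hb w hw.2 hw.1
    have hcard : (insert v ((G.neighborFinset v).erase b)).card = 3 := by
      rw [Finset.card_insert_of_notMem (by simp),
        Finset.card_erase_of_mem (by simpa using hvb), card_neighborFinset_eq_degree, hthree]
    have heq := Finset.eq_of_subset_of_card_le hsub (by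
      rw [hcard, card_neighborFinset_eq_degree, hthree])
    have hdead : b ∈ G.deadLeaves {v} := by
      rw [mem_deadLeaves, outerBoundary_singleton]
      refine ⟨by simpa using hvb, fun w hw => ?_⟩
      rw [← mem_neighborFinset, ← heq, Finset.mem_insert, Finset.mem_erase,
        mem_neighborFinset] at hw
      rw [mem_closedNbhd]
      rcases hw with rfl | hw
      · simp
      · exact Or.inr ⟨v, by simp, hw.2⟩
    refine ⟨{v}, Finset.singleton_nonempty v, walkConnectedOn_singleton v, ?_, hdom v⟩
    have := hstar v
    have := hthree v
    have := Finset.card_singleton v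
    have := Finset.card_pos.2 ⟨b, hdead⟩
    unfold leafPotential
    omega
  · push Not at htri
    obtain ⟨u, hvu, hu⟩ := htri
    have huB : u ∈ G.outerBoundary {v} := by
      rw [outerBoundary_singleton]
      simpa using hvu
    have hnew : (G.neighborFinset u).erase v ⊆ G.newNbrs {v} u := by
      intro w hw
      rw [Finset.mem_erase, mem_neighborFinset] at hw
      rw [mem_newNbrs, mem_closedNbhd]
      refine ⟨hw.2, ?_⟩
      rintro (h | ⟨z, hz, hzw⟩)
      · exact hw.1 (Finset.mem_singleton.1 h)
      · obtain rfl := Finset.mem_singleton.1 hz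
        exact hu w hzw hw.2
    have hcard := Finset.card_le_card hnew
    rw [Finset.card_erase_of_mem (by simpa using hvu.symm), card_neighborFinset_eq_degree,
      hthree] at hcard
    have hb := card_outerBoundary_insert huB
    have hi := card_insert_of_mem_outerBoundary huB
    have := hstar v
    have := hthree v
    have := Finset.card_singleton v
    refine ⟨insert u {v}, Finset.insert_nonempty _ _, (walkConnectedOn_singleton v).insert huB,
      ?_, fun h => ?_⟩
    · unfold leafPotential
      omega
    · have := congrArg Finset.card (deadLeaves_eq_outerBoundary h)
      unfold leafPotential
      omega

/-- A connected graph with minimum degree at least three has a connected dominating set whose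
complement has at least `n / 4 + 2` vertices. -/
theorem exists_connected_dominating (hG : G.Connected) (hδ : ∀ v, 3 ≤ G.degree v) :
    ∃ I : Finset V, I.Nonempty ∧ G.WalkConnectedOn I ∧
      (∀ v, v ∈ I ∨ ∃ u ∈ I, G.Adj u v) ∧
      Fintype.card V + 8 ≤ 4 * (Fintype.card V - I.card) := by
  obtain ⟨I, hI, hconn, h6, h8⟩ := exists_initial_leafPotential hG hδ
  obtain ⟨J, hJ, hJconn, hJdom, hJ8⟩ := exists_dominating_of_leafPotential hG hδ hI hconn h6 h8
  refine ⟨J, hJ, hJconn, fun v => mem_closedNbhd.1 (hJdom ▸ Finset.mem_univ v), ?_⟩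
  have := congrArg Finset.card (deadLeaves_eq_outerBoundary hJdom)
  have := card_outerBoundary_add hJdom
  unfold leafPotential at hJ8
  omega

end Growth

variable {G : SimpleGraph V} {I : Finset V}

/-- A coloring that is constant on a connected dominating set is an MVC-coloring. -/
lemma isMVCColoring_of_dominating (hconn : G.WalkConnectedOn I)
    (hdom : ∀ v, v ∈ I ∨ ∃ u ∈ I, G.Adj u v) {c : V → ℕ}
    (hc : ∀ x ∈ I, ∀ y ∈ I, c x = c y) : IsMVCColoring G c := by
  classical
  have hattach : ∀ v, ∃ z ∈ I, ∃ p : G.Walk z v, ∀ x ∈ p.support, x ∈ I ∨ x = v := by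
    intro v
    rcases hdom v with hv | ⟨u, hu, huv⟩
    · exact ⟨v, hv, Walk.nil, by simp⟩
    · exact ⟨u, hu, huv.toWalk, by simp [hu]⟩
  intro u v
  obtain ⟨a, ha, p, hp⟩ := hattach u
  obtain ⟨b, hb, q, hq⟩ := hattach v
  obtain ⟨r, hr⟩ := hconn a ha b hb
  let w : G.Walk u v := p.reverse.append (r.append q)
  have hw : ∀ x ∈ w.support, x ∈ I ∨ x = u ∨ x = v := by
    intro x hx
    simp only [w, Walk.mem_support_append_iff, Walk.support_reverse, List.mem_reverse] at hx
    grind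
  have hinner : ∀ x ∈ w.bypass.support.tail.dropLast, x ∈ I := by
    intro x hx
    have hpath := w.bypass_isPath
    have hnodup := hpath.support_nodup
    have hmem := List.mem_of_mem_dropLast hx
    have hxu : x ≠ u := by
      rintro rfl
      rw [← Walk.cons_tail_support] at hnodup
      exact (List.nodup_cons.1 hnodup).1 hmem
    have hxv : x ≠ v := by
      rintro rfl
      rw [← List.tail_dropLast] at hx
      have hx' := List.mem_of_mem_tail hx
      have hne : w.bypass.support ≠ [] := Walk.support_ne_nil _
      rw [← List.dropLast_append_getLast hne, Walk.getLast_support] at hnodup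
      exact (List.nodup_append.1 hnodup).2.2 x hx' x (by simp) rfl
    rcases hw x (w.support_bypass_subset_support (List.mem_of_mem_tail hmem)) with h | h | h
    · exact h
    · exact absurd h hxu
    · exact absurd h hxv
  exact ⟨w.bypass, w.bypass_isPath, fun x hx y hy => hc x (hinner x hx) y (hinner y hy)⟩

lemma ncard_range_le_mvc [Finite V] {c : V → ℕ} (hc : IsMVCColoring G c) :
    (Set.range c).ncard ≤ mvc G := by
  refine le_csSup ⟨Nat.card V, ?_⟩ ⟨c, hc, rfl⟩
  rintro k ⟨d, -, rfl⟩
  rw [← Set.image_univ, ← Set.ncard_univ]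
  exact Set.ncard_image_le

lemma card_sub_card_add_one_le_mvc [Fintype V] (hI : I.Nonempty) (hconn : G.WalkConnectedOn I)
    (hdom : ∀ v, v ∈ I ∨ ∃ u ∈ I, G.Adj u v) : Fintype.card V - I.card + 1 ≤ mvc G := by
  classical
  obtain ⟨i, hi⟩ := hI
  let c : V → ℕ := fun v => if v ∈ I then 0 else (Fintype.equivFin V v : ℕ) + 1
  have hc : IsMVCColoring G c :=
    isMVCColoring_of_dominating hconn hdom fun x hx y hy => by simp [c, hx, hy]
  refine le_trans ?_ (ncard_range_le_mvc hc)
  have hinj : Set.InjOn c (insert i Iᶜ : Finset V) := by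
    intro x hx y hy hxy
    simp only [Finset.coe_insert, Set.mem_insert_iff, Finset.mem_coe, Finset.mem_compl] at hx hy
    by_cases hxI : x ∈ I <;> by_cases hyI : y ∈ I
    · rw [hx.resolve_right (not_not.2 hxI), hy.resolve_right (not_not.2 hyI)]
    · simp [c, hxI, hyI] at hxy
    · simp [c, hxI, hyI] at hxy
    · simpa [c, hxI, hyI, Fin.val_inj] using hxy
  calc Fintype.card V - I.card + 1 = (insert i Iᶜ : Finset V).card := by
        rw [Finset.card_insert_of_notMem (by simpa using hi), Finset.card_compl]
    _ = (c '' (insert i Iᶜ : Finset V)).ncard := by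
        rw [hinj.ncard_image, Set.ncard_coe_finset]
    _ ≤ (Set.range c).ncard :=
        Set.ncard_le_ncard (Set.image_subset_range _ _) (Set.finite_range c)

end SimpleGraph

theorem stmt_1 {V : Type*} [Fintype V] (G : SimpleGraph V) [DecidableRel G.Adj]
    (hG : G.Connected) (hδ : 3 ≤ G.minDegree) :
    (Fintype.card V : ℝ) / 4 + 3 ≤ (mvc G : ℝ) := by
  classical
  obtain ⟨I, hI, hconn, hdom, hcard⟩ :=
    exists_connected_dominating hG fun v => hδ.trans (G.minDegree_le_degree v)
  have hle := card_sub_card_add_one_le_mvc hI hconn hdom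
  have hnat : Fintype.card V + 12 ≤ 4 * mvc G := by omega
  have hreal : (Fintype.card V : ℝ) + 12 ≤ 4 * (mvc G : ℝ) := by exact_mod_cast hnat
  linarith
end

section
/- Let G be a connected graph on n vertices with minimum degree δ ≥ 5. Then mvc(G) ≥ n/2 + 3. -/
open SimpleGraph

namespace MVC

section Growth

variable {V : Type*} [Fintype V] [DecidableEq V] (G : SimpleGraph V) [DecidableRel G.Adj]

/-- Adding the neighbours of `b` to `A` turns `v` into a vertex all of whose closed neighbourhood
is covered, which it was not before. -/
def NewlySaturated (A : Finset V) (b v : V) : Prop :=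
  (v ∈ A ∨ G.Adj b v) ∧ (∀ w, G.Adj v w → w ∈ A ∨ G.Adj b w) ∧ (v ∈ A → ∃ w, G.Adj v w ∧ w ∉ A)

/-- `St A t` says that the covered set `A` can be reached from `A₀` with a loss of potential of at
most `t`.  Expanding a covered vertex `b` gains `3` for each newly covered vertex and `1` for each
newly saturated one, at a cost of `8`; every proper extension loses at least `1`. -/
structure Growth (A₀ : Finset V) (St : Finset V → ℤ → Prop) : Prop where
  base : St A₀ 0
  expand : ∀ {A : Finset V} {t : ℤ} {b : V} (T : Finset V), St A t → b ∈ A →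
    (∃ w, G.Adj b w ∧ w ∉ A) → b ∉ T → (∀ v ∈ T, NewlySaturated G A b v) →
    St (A ∪ G.neighborFinset b) (t + 7 - 3 * (G.neighborFinset b \ A).card - T.card)
  pos : ∀ {A : Finset V} {t : ℤ}, St A t → A ≠ A₀ → 1 ≤ t
  mono : ∀ {A : Finset V} {t t' : ℤ}, St A t → t ≤ t' → St A t'
  subset : ∀ {A : Finset V} {t : ℤ}, St A t → A₀ ⊆ A

variable {G} {A₀ : Finset V} {St : Finset V → ℤ → Prop}

namespace Growth

theorem expand_to (h : Growth G A₀ St) {A A' : Finset V} {t t' : ℤ} {b : V} (m s : ℕ)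
    (T : Finset V) (hA : St A t) (hb : b ∈ A) (hm : m ≤ (G.neighborFinset b \ A).card)
    (hm1 : 1 ≤ m) (hbT : b ∉ T) (hT : ∀ v ∈ T, NewlySaturated G A b v) (hs : s ≤ T.card)
    (hA' : ∀ v, v ∈ A' ↔ v ∈ A ∨ G.Adj b v) (ht : t + 7 - 3 * m - s ≤ t') :
    St A' t' := by
  have hw : ∃ w, G.Adj b w ∧ w ∉ A := by
    obtain ⟨w, hw⟩ := Finset.card_pos.1 (by omega : 0 < (G.neighborFinset b \ A).card)
    exact ⟨w, by simpa using hw⟩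
  have e : A' = A ∪ G.neighborFinset b := by
    ext v; simp [hA']
  subst e
  exact h.mono (h.expand T hA hb hw hbT hT) (by omega)

theorem contra (h : Growth G A₀ St) {A : Finset V} {t : ℤ} {b : V} (m s : ℕ)
    (T : Finset V) (hA : St A t) (hb : b ∈ A) (hm : m ≤ (G.neighborFinset b \ A).card)
    (hm1 : 1 ≤ m) (hbT : b ∉ T) (hT : ∀ v ∈ T, NewlySaturated G A b v) (hs : s ≤ T.card)
    (ht : t + 7 - 3 * m - s ≤ 0) : False := by
  have h1 : St (A ∪ G.neighborFinset b) 0 :=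
    h.expand_to m s T hA hb hm hm1 hbT hT hs (by simp) ht
  obtain ⟨w, hw⟩ := Finset.card_pos.1 (by omega : 0 < (G.neighborFinset b \ A).card)
  have hw' : G.Adj b w ∧ w ∉ A := by simpa using hw
  have := h.pos h1 (by
    rintro e
    apply hw'.2
    apply h.subset hA
    rw [← e]; simp [hw'.1])
  omega

theorem card_out_le (h : Growth G A₀ St) {A : Finset V} {t : ℤ} (hA : St A t) {b : V} (hb : b ∈ A)
    (ht : t ≤ 2) : (G.neighborFinset b \ A).card ≤ 2 := by
  by_contra hc
  exact h.contra 3 0 ∅ hA hb (by omega) (by norm_num) (by simp) (by simp) (by simp) (by omega)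

end Growth

/-- A vertex of degree at least `m + B.card` whose covered neighbours lie in `B` has at least `m`
uncovered neighbours. -/
theorem le_card_out {A B : Finset V} {z : V} {m d : ℕ} (hd : d ≤ (G.neighborFinset z).card)
    (hB : ∀ w, G.Adj z w → w ∈ A → w ∈ B) (hm : m + B.card ≤ d) :
    m ≤ (G.neighborFinset z \ A).card := by
  have h1 := Finset.card_sdiff_add_card_inter (G.neighborFinset z) A
  have h2 : (G.neighborFinset z ∩ A).card ≤ B.card := by
    apply Finset.card_le_card
    intro w hw
    simp only [Finset.mem_inter, mem_neighborFinset] at hw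
    exact hB w hw.1 hw.2
  omega

end Growth

section Extension

variable {V : Type*} [Fintype V] [DecidableEq V] {G : SimpleGraph V} [DecidableRel G.Adj]
  {A₀ : Finset V} {St : Finset V → ℤ → Prop}

theorem two_le_card_out {A : Finset V} {b x y : V} (hx : G.Adj b x) (hxA : x ∉ A)
    (hy : G.Adj b y) (hyA : y ∉ A) (hxy : x ≠ y) : 2 ≤ (G.neighborFinset b \ A).card := by
  rw [← Finset.card_pair hxy]
  apply Finset.card_le_card
  intro w hw
  simp only [Finset.mem_insert, Finset.mem_singleton] at hw
  rcases hw with rfl | rfl <;> simp [*]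

theorem one_le_card_out {A : Finset V} {b x : V} (hx : G.Adj b x) (hxA : x ∉ A) :
    1 ≤ (G.neighborFinset b \ A).card :=
  Finset.card_pos.2 ⟨x, by simp [*]⟩

theorem exists_pair_of_card_out {A : Finset V} {b : V} (h : (G.neighborFinset b \ A).card = 2) :
    ∃ x y, x ≠ y ∧ ∀ w, (G.Adj b w ∧ w ∉ A) ↔ w = x ∨ w = y := by
  obtain ⟨x, y, hxy, e⟩ := Finset.card_eq_two.1 h
  refine ⟨x, y, hxy, fun w => ?_⟩
  have := congrArg (w ∈ ·) e
  simpa using this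

theorem exists_triple_of_card_out {A : Finset V} {b : V} (h : (G.neighborFinset b \ A).card = 3) :
    ∃ x y z, x ≠ y ∧ x ≠ z ∧ y ≠ z ∧ ∀ w, (G.Adj b w ∧ w ∉ A) ↔ w = x ∨ w = y ∨ w = z := by
  obtain ⟨x, y, z, hxy, hxz, hyz, e⟩ := Finset.card_eq_three.1 h
  refine ⟨x, y, z, hxy, hxz, hyz, fun w => ?_⟩
  have := congrArg (w ∈ ·) e
  simpa using this

/-- The uncovered neighbours of the covered vertex `b` are exactly `x` and `y`. -/
def PairOut (G : SimpleGraph V) (A : Finset V) (b x y : V) : Prop :=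
  b ∈ A ∧ x ≠ y ∧ ∀ w, (G.Adj b w ∧ w ∉ A) ↔ w = x ∨ w = y

theorem PairOut.symm {A : Finset V} {b x y : V} (h : PairOut G A b x y) : PairOut G A b y x :=
  ⟨h.1, h.2.1.symm, fun w => by rw [h.2.2, or_comm]⟩

theorem PairOut.two_le {A A' : Finset V} {b x y : V} (h : PairOut G A b x y) (hx : x ∉ A')
    (hy : y ∉ A') : 2 ≤ (G.neighborFinset b \ A').card :=
  two_le_card_out ((h.2.2 x).2 (Or.inl rfl)).1 hx ((h.2.2 y).2 (Or.inr rfl)).1 hy h.2.1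

theorem Growth.exists_pairOut_path (h : Growth G A₀ St) (f : ℕ → V) (j : ℕ)
    (hinj : ∀ a < 2 * j + 2, ∀ b < 2 * j + 2, f a = f b → a = b)
    (hP : ∀ i < 2 * j + 1, ∃ c, PairOut G A₀ c (f i) (f (i + 1))) :
    St (A₀ ∪ (Finset.range (2 * j + 2)).image f) 1 ∧
    ∀ v, v ∈ A₀ ∪ (Finset.range (2 * j + 2)).image f →
      (∀ w, G.Adj v w → w ∈ A₀ ∪ (Finset.range (2 * j + 2)).image f) →
      (v ∈ A₀ → ∃ w, G.Adj v w ∧ w ∉ A₀) → ∃ i < 2 * j + 1, PairOut G A₀ v (f i) (f (i + 1)) := by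
  induction j with
  | zero =>
    obtain ⟨b, hb⟩ := hP 0 (by norm_num)
    have hx := ((hb.2.2 (f 0)).2 (Or.inl rfl))
    have hy := ((hb.2.2 (f 1)).2 (Or.inr rfl))
    have hmem : ∀ v, v ∈ A₀ ∪ (Finset.range (2 * 0 + 2)).image f ↔ v ∈ A₀ ∨ G.Adj b v := by
      intro v
      have := hb.2.2 v
      simp [Finset.range_add_one]
      simp at this
      grind
    constructor
    · exact h.expand_to 2 0 ∅ h.base hb.1 (hb.two_le hx.2 hy.2) (by norm_num) (by simp) (by simp)
        (by simp) hmem (by norm_num)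
    · intro v hv hv1 hv2
      by_contra hc
      have hvb : v ≠ b := by
        rintro rfl
        exact hc ⟨0, by norm_num, hb⟩
      refine h.contra 2 1 {v} h.base hb.1 (hb.two_le hx.2 hy.2) (by norm_num) (by simpa using hvb.symm)
        ?_ (by simp) (by norm_num)
      simp only [Finset.mem_singleton, forall_eq]
      exact ⟨(hmem v).1 hv, fun w hw => (hmem w).1 (hv1 w hw), hv2⟩
  | succ j ih =>
    obtain ⟨ih1, ih2⟩ := ih (fun a ha b hb => hinj a (by omega) b (by omega))
      (fun i hi => hP i (by omega))
    set A := A₀ ∪ (Finset.range (2 * j + 2)).image f with hAdef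
    obtain ⟨e, he⟩ := hP (2 * j + 2) (by omega)
    obtain ⟨l, hl⟩ := hP (2 * j + 1) (by omega)
    have hfA : ∀ i < 2 * (j + 1) + 2, f i ∉ A₀ := by
      intro i hi
      rcases Nat.lt_or_ge i (2 * (j+1) + 1) with h1 | h1
      · obtain ⟨c, hc⟩ := hP i h1
        exact ((hc.2.2 _).2 (Or.inl rfl)).2
      · obtain ⟨c, hc⟩ := hP (i-1) (by omega)
        have := ((hc.2.2 _).2 (Or.inr rfl)).2
        rwa [Nat.sub_add_cancel (by omega)] at this
    have hnA : ∀ i, 2 * j + 2 ≤ i → i < 2 * (j + 1) + 2 → f i ∉ A := by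
      intro i h1 h2
      simp only [hAdef, Finset.mem_union, Finset.mem_image, Finset.mem_range, not_or, not_exists]
      refine ⟨hfA i h2, ?_⟩
      rintro a ⟨ha, e⟩
      have := hinj a (by omega) i h2 e
      omega
    have hAsub : ∀ v, v ∈ A₀ → v ∈ A := fun v hv => Finset.mem_union_left _ hv
    have hfmem : ∀ i < 2 * j + 2, f i ∈ A := by
      intro i hi
      simp only [hAdef, Finset.mem_union, Finset.mem_image, Finset.mem_range]
      exact Or.inr ⟨i, hi, rfl⟩
    have hmem : ∀ v, v ∈ A₀ ∪ (Finset.range (2 * (j + 1) + 2)).image f ↔ v ∈ A ∨ G.Adj e v := by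
      intro v
      have h1 := he.2.2 v
      have h2 : v ∈ A₀ ∪ (Finset.range (2 * (j + 1) + 2)).image f ↔
          v ∈ A ∨ v = f (2 * j + 2) ∨ v = f (2 * j + 3) := by
        rw [show 2 * (j + 1) + 2 = 2 * j + 2 + 1 + 1 by ring, Finset.range_add_one,
          Finset.range_add_one, hAdef]
        simp only [Finset.image_insert, Finset.mem_union, Finset.mem_insert]
        constructor
        · rintro (h | h | h | h) <;> simp [h]
        · rintro ((h | h) | h | h) <;> simp [h]
      rw [h2, ← h1]
      constructor
      · rintro (h | h)
        · exact Or.inl h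
        · exact Or.inr h.1
      · rintro (h | h)
        · exact Or.inl h
        · by_cases hv : v ∈ A₀
          · exact Or.inl (hAsub v hv)
          · exact Or.inr ⟨h, hv⟩
    have hel : e ≠ l := by
      rintro rfl
      rcases (he.2.2 _).1 ((hl.2.2 (f (2 * j + 1))).2 (Or.inl rfl)) with h1 | h1
      · have := hinj _ (by omega) _ (by omega) h1; omega
      · have := hinj _ (by omega) _ (by omega) h1; omega
    have hlsat : NewlySaturated G A e l := by
      refine ⟨Or.inl (hAsub _ hl.1), ?_, ?_⟩
      · intro w hw
        by_cases hwA : w ∈ A₀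
        · exact Or.inl (hAsub _ hwA)
        · rcases (hl.2.2 w).1 ⟨hw, hwA⟩ with rfl | rfl
          · exact Or.inl (hfmem _ (by omega))
          · exact Or.inr ((he.2.2 _).2 (Or.inl rfl)).1
      · intro _
        exact ⟨f (2 * j + 2), ((hl.2.2 _).2 (Or.inr rfl)).1, hnA _ (by omega) (by omega)⟩
    have h2 : 2 ≤ (G.neighborFinset e \ A).card :=
      he.two_le (hnA _ (by omega) (by omega)) (hnA _ (by omega) (by omega))
    constructor
    · exact h.expand_to 2 1 {l} ih1 (hAsub _ he.1) h2 (by norm_num) (by simpa using hel)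
        (by simpa using hlsat) (by simp) hmem (by norm_num)
    · intro v hv hv1 hv2
      by_contra hc
      have hve : v ≠ e := by
        rintro rfl
        exact hc ⟨2 * j + 2, by omega, he⟩
      have hvl : v ≠ l := by
        rintro rfl
        exact hc ⟨2 * j + 1, by omega, hl⟩
      by_cases hsat : v ∈ A ∧ ∀ w, G.Adj v w → w ∈ A
      · obtain ⟨i, hi, hi'⟩ := ih2 v hsat.1 hsat.2 hv2
        exact hc ⟨i, by omega, hi'⟩
      · refine h.contra 2 2 {l, v} ih1 (hAsub _ he.1) h2 (by norm_num)
          (by simp [hel, hve.symm]) ?_ (by rw [Finset.card_pair hvl.symm]) (by norm_num)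
        simp only [Finset.mem_insert, Finset.mem_singleton, forall_eq_or_imp, forall_eq]
        refine ⟨hlsat, (hmem v).1 hv, fun w hw => (hmem w).1 (hv1 w hw), fun hvA => ?_⟩
        push Not at hsat
        exact hsat hvA

theorem Growth.not_pairOut_chord (h : Growth G A₀ St) (f : ℕ → V) (j : ℕ)
    (hinj : ∀ a < 2 * j + 2, ∀ b < 2 * j + 2, f a = f b → a = b)
    (hP : ∀ i < 2 * j + 1, ∃ c, PairOut G A₀ c (f i) (f (i + 1))) {b : ℕ}
    (hb : b < 2 * j + 2) {c : V} (hc : PairOut G A₀ c (f 0) (f b)) : b = 1 := by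
  obtain ⟨-, h2⟩ := h.exists_pairOut_path f j hinj hP
  have hm : ∀ i < 2 * j + 2, f i ∈ A₀ ∪ (Finset.range (2 * j + 2)).image f := fun i hi =>
    Finset.mem_union_right _ (Finset.mem_image.2 ⟨i, by simpa using hi, rfl⟩)
  obtain ⟨i, hi, hi'⟩ := h2 c (Finset.mem_union_left _ hc.1) (by
    intro w hw
    by_cases hwA : w ∈ A₀
    · exact Finset.mem_union_left _ hwA
    · rcases (hc.2.2 w).1 ⟨hw, hwA⟩ with rfl | rfl
      · exact hm _ (by omega)
      · exact hm _ hb) (fun _ => ⟨f 0, (hc.2.2 _).2 (Or.inl rfl)⟩)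
  have e0 := (hi'.2.2 _).1 ((hc.2.2 (f 0)).2 (Or.inl rfl))
  have e1 := (hi'.2.2 _).1 ((hc.2.2 (f b)).2 (Or.inr rfl))
  have hne : b ≠ 0 := by
    rintro rfl
    exact hc.2.1 rfl
  have e0' : 0 = i ∨ 0 = i + 1 := e0.imp (hinj _ (by omega) _ (by omega)) (hinj _ (by omega) _ (by omega))
  have e1' : b = i ∨ b = i + 1 := e1.imp (hinj _ (by omega) _ (by omega)) (hinj _ (by omega) _ (by omega))
  omega

theorem PairOut.left {A : Finset V} {b x y : V} (h : PairOut G A b x y) : G.Adj b x ∧ x ∉ A :=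
  (h.2.2 x).2 (Or.inl rfl)

theorem PairOut.right {A : Finset V} {b x y : V} (h : PairOut G A b x y) : G.Adj b y ∧ y ∉ A :=
  (h.2.2 y).2 (Or.inr rfl)

theorem Growth.pairOut_unique (h : Growth G A₀ St) {b c x y : V} (hb : PairOut G A₀ b x y)
    (hc : c ∈ A₀) (hcx : ∃ w, G.Adj c w ∧ w ∉ A₀)
    (hc' : ∀ w, G.Adj c w → w ∉ A₀ → w = x ∨ w = y) : c = b := by
  by_contra hne
  refine h.contra 2 1 {c} h.base hb.1 (hb.two_le hb.left.2 hb.right.2) (by norm_num)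
    (by simpa using Ne.symm hne) ?_ (by simp) (by norm_num)
  simp only [Finset.mem_singleton, forall_eq]
  refine ⟨Or.inl hc, fun w hw => ?_, fun _ => hcx⟩
  by_cases hwA : w ∈ A₀
  · exact Or.inl hwA
  · rcases hc' w hw hwA with rfl | rfl
    · exact Or.inr hb.left.1
    · exact Or.inr hb.right.1

theorem Growth.exists_pairOut_of_adj (h : Growth G A₀ St) {b c x y : V} (hb : PairOut G A₀ b x y)
    (hc : c ∈ A₀) (hcx : G.Adj x c) : ∃ y', PairOut G A₀ c x y' := by
  have h2 := h.card_out_le h.base hc (by norm_num)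
  have hx : x ∈ G.neighborFinset c \ A₀ := by simp [hcx.symm, hb.left.2]
  rcases Nat.lt_or_ge (G.neighborFinset c \ A₀).card 2 with h1 | h1
  · have h3 : ∀ w, G.Adj c w → w ∉ A₀ → w = x := by
      intro w hw hwA
      exact Finset.card_le_one.1 (by omega) w (by simp [hw, hwA]) x hx
    have : c = b := h.pairOut_unique hb hc ⟨x, hcx.symm, hb.left.2⟩
      (fun w hw hwA => Or.inl (h3 w hw hwA))
    subst this
    exact ⟨y, hb⟩
  · obtain ⟨p, q, hpq, hw⟩ := exists_pair_of_card_out (le_antisymm h2 h1)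
    rcases (hw x).1 ⟨hcx.symm, hb.left.2⟩ with rfl | rfl
    · exact ⟨q, hc, hpq, hw⟩
    · exact ⟨p, PairOut.symm ⟨hc, hpq, hw⟩⟩

theorem Growth.card_inter_le_of_pairOut (h : Growth G A₀ St) {b x y : V}
    (hb : PairOut G A₀ b x y) (Y : Finset V) (hY : ∀ y' c, PairOut G A₀ c x y' → y' ∈ Y) :
    (G.neighborFinset x ∩ A₀).card ≤ Y.card := by
  have key : ∀ c, ∃ y', c ∈ G.neighborFinset x ∩ A₀ → PairOut G A₀ c x y' := by
    intro c
    by_cases hc : c ∈ G.neighborFinset x ∩ A₀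
    · simp only [Finset.mem_inter, mem_neighborFinset] at hc
      obtain ⟨y', hy'⟩ := h.exists_pairOut_of_adj hb hc.2 hc.1
      exact ⟨y', fun _ => hy'⟩
    · exact ⟨x, fun h => absurd h hc⟩
  choose g hg using key
  apply Finset.card_le_card_of_injOn g
  · intro c hc
    exact hY _ c (hg c hc)
  · intro c hc c' hc' e
    have h1 := hg c hc
    have h2 := hg c' hc'
    rw [← show g c = g c' from e] at h2
    exact h.pairOut_unique h2 h1.1 ⟨x, h1.left⟩ (fun w hw hwA => (h1.2.2 w).1 ⟨hw, hwA⟩)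

theorem Growth.card_out_le_of_pairOut (h : Growth G A₀ St) {b x y : V}
    (hb : PairOut G A₀ b x y) : (G.neighborFinset x \ (insert y A₀)).card ≤ 2 := by
  have hS : St (insert x (insert y A₀)) 1 := by
    refine h.expand_to 2 0 ∅ h.base hb.1 (hb.two_le hb.left.2 hb.right.2) (by norm_num)
      (by simp) (by simp) (by simp) ?_ (by norm_num)
    intro v
    have := hb.2.2 v
    grind
  have := h.card_out_le hS (b := x) (by simp) (by norm_num)
  refine le_trans (Finset.card_le_card ?_) this
  intro w hw
  simp only [Finset.mem_sdiff, mem_neighborFinset, Finset.mem_insert, not_or] at hw ⊢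
  exact ⟨hw.1, hw.1.ne', hw.2⟩

theorem Growth.exists_pairOut_ne (h : Growth G A₀ St)
    (hd : ∀ v, 5 ≤ (G.neighborFinset v).card) {b x y : V}
    (hb : PairOut G A₀ b x y) : ∃ y' c, y' ≠ y ∧ PairOut G A₀ c x y' := by
  by_contra hc
  push Not at hc
  have h1 := h.card_inter_le_of_pairOut hb {y} (by
    intro y' c hc'
    by_contra hy
    exact hc y' c (by simpa using hy) hc')
  have h2 := h.card_out_le_of_pairOut hb
  have h3 := Finset.card_sdiff_add_card_inter (G.neighborFinset x) A₀
  have h4 : (G.neighborFinset x \ A₀).card ≤ (insert y (G.neighborFinset x \ (insert y A₀))).card := by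
    apply Finset.card_le_card
    intro w; simp; tauto
  have h5 := Finset.card_insert_le y (G.neighborFinset x \ (insert y A₀))
  have := hd x
  simp at h1
  omega

theorem Growth.exists_third_of_pairOut (h : Growth G A₀ St)
    (hd : ∀ v, 5 ≤ (G.neighborFinset v).card) {b b' x y y' : V}
    (hb : PairOut G A₀ b x y) (hb' : PairOut G A₀ b' x y') (hne : y ≠ y')
    (hY : ∀ z c, PairOut G A₀ c x z → z = y ∨ z = y') :
    ∃ w, w ≠ y ∧ w ≠ y' ∧ w ∉ A₀ ∧ G.Adj x w ∧ G.Adj x y ∧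
      ∀ v, G.Adj x v → v ∈ A₀ ∨ v = y ∨ v = y' ∨ v = w := by
  have h1 := h.card_inter_le_of_pairOut hb {y, y'} (by simpa using hY)
  rw [Finset.card_pair hne] at h1
  have h3 := Finset.card_sdiff_add_card_inter (G.neighborFinset x) A₀
  have key : ∀ {b y}, PairOut G A₀ b x y → G.Adj x y ∧ (G.neighborFinset x \ A₀).card ≤ 3 := by
    intro b y hb
    have h2 := h.card_out_le_of_pairOut hb
    have h4 : G.neighborFinset x \ (insert y A₀) = (G.neighborFinset x \ A₀).erase y := by
      ext w; simp; tauto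
    by_cases hy : y ∈ G.neighborFinset x \ A₀
    · rw [h4, Finset.card_erase_of_mem hy] at h2
      simp only [Finset.mem_sdiff, mem_neighborFinset] at hy
      exact ⟨hy.1, by omega⟩
    · rw [h4, Finset.erase_eq_of_notMem hy] at h2
      have := hd x
      omega
  obtain ⟨k1, k2⟩ := key hb
  obtain ⟨k3, -⟩ := key hb'
  have := hd x
  obtain ⟨p, q, r, hpq, hpr, hqr, hw⟩ :=
    exists_triple_of_card_out (G := G) (A := A₀) (b := x) (by omega)
  have hy := (hw y).1 ⟨k1, hb.right.2⟩
  have hy' := (hw y').1 ⟨k3, hb'.right.2⟩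
  have hp := (hw p).2 (by simp)
  have hq := (hw q).2 (by simp)
  have hr := (hw r).2 (by simp)
  have hall : ∀ v, G.Adj x v → v ∈ A₀ ∨ v = p ∨ v = q ∨ v = r := by
    intro v hv
    have := hw v
    tauto
  clear hw h1 h3 hY key
  rcases hy with rfl | rfl | rfl <;> rcases hy' with rfl | rfl | rfl <;>
    first
    | exact absurd rfl hne
    | exact ⟨p, by grind⟩
    | exact ⟨q, by grind⟩
    | exact ⟨r, by grind⟩

/-- The first `r` values of `f` form a path in the graph of uncovered pairs. -/
def PairPath (G : SimpleGraph V) (A : Finset V) (r : ℕ) (f : ℕ → V) : Prop :=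
  (∀ a < r, ∀ b < r, f a = f b → a = b) ∧ ∀ i, i + 1 < r → ∃ c, PairOut G A c (f i) (f (i + 1))

theorem PairPath.le_card {A : Finset V} {r : ℕ} {f : ℕ → V} (hf : PairPath G A r f) :
    r ≤ Fintype.card V := by
  rw [← Finset.card_univ, ← Finset.card_range r]
  apply Finset.card_le_card_of_injOn f (by simp)
  intro a ha b hb e
  exact hf.1 a (by simpa using ha) b (by simpa using hb) e

theorem Growth.pairPath_max (h : Growth G A₀ St) (hd : ∀ v, 5 ≤ (G.neighborFinset v).card)
    {r : ℕ} (hr : 2 ≤ r) (hmax : ∀ g, ¬ PairPath G A₀ (r + 1) g) {f : ℕ → V}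
    (hf : PairPath G A₀ r f) :
    r % 2 = 1 ∧ (∃ c, PairOut G A₀ c (f 0) (f (r - 1))) ∧
      ∀ c z, PairOut G A₀ c (f 0) z → z = f 1 ∨ z = f (r - 1) := by
  have key : ∀ c z, PairOut G A₀ c (f 0) z → z = f 1 ∨ (r % 2 = 1 ∧ z = f (r - 1)) := by
    intro c z hc
    by_cases hz : ∃ i < r, f i = z
    · obtain ⟨i, hi, rfl⟩ := hz
      have hi0 : i ≠ 0 := by
        rintro rfl
        exact hc.2.1 rfl
      rcases Nat.even_or_odd' i with ⟨j, e | e⟩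
      · by_cases hlt : i + 1 < r
        · have := h.not_pairOut_chord f j (fun a ha b hb => hf.1 a (by omega) b (by omega))
            (fun i hi => hf.2 i (by omega)) (b := i) (by omega) hc
          omega
        · right
          exact ⟨by omega, by congr 1; omega⟩
      · left
        have := h.not_pairOut_chord f j (fun a ha b hb => hf.1 a (by omega) b (by omega))
            (fun i hi => hf.2 i (by omega)) (b := i) (by omega) hc
        rw [this]
    · exfalso
      push Not at hz
      refine hmax (fun i => if i = 0 then z else f (i - 1)) ⟨?_, ?_⟩
      · intro a ha b hb
        by_cases ha0 : a = 0 <;> by_cases hb0 : b = 0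
        · simp [ha0, hb0]
        · simp only [ha0, hb0, if_true, if_false]
          intro e
          exact absurd e.symm (hz _ (by omega))
        · simp only [ha0, hb0, if_true, if_false]
          intro e
          exact absurd e (hz _ (by omega))
        · simp only [ha0, hb0, if_false]
          intro e
          have := hf.1 _ (by omega) _ (by omega) e
          omega
      · intro i hi
        rcases i with _ | i
        · exact ⟨c, by simpa using hc.symm⟩
        · simpa using hf.2 i (by omega)
  obtain ⟨b, hb⟩ := hf.2 0 (by omega)
  obtain ⟨y, c, hy, hc⟩ := h.exists_pairOut_ne hd hb
  rcases key c y hc with h1 | ⟨h1, h2⟩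
  · exact absurd h1 hy
  · exact ⟨h1, ⟨c, h2 ▸ hc⟩, fun c z hz => (key c z hz).imp_right And.right⟩

theorem Growth.not_pairOut (h : Growth G A₀ St) (hd : ∀ v, 5 ≤ (G.neighborFinset v).card)
    {b x y : V} : ¬ PairOut G A₀ b x y := by
  intro hb
  have hex : ∃ r f, 2 ≤ r ∧ PairPath G A₀ r f ∧ ∀ g, ¬ PairPath G A₀ (r + 1) g := by
    by_contra hc
    push Not at hc
    have : ∀ n, ∃ f, PairPath G A₀ (n + 2) f := by
      intro n
      induction n with
      | zero =>
        refine ⟨fun i => if i = 0 then x else y, ?_, ?_⟩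
        · intro a ha b' hb'
          have := hb.2.1
          have := this.symm
          interval_cases a <;> interval_cases b' <;> simp [*]
        · intro i hi
          have : i = 0 := by omega
          subst this
          exact ⟨b, by simpa using hb⟩
      | succ n ih =>
        obtain ⟨f, hf⟩ := ih
        exact hc (n + 2) f (by omega) hf
    obtain ⟨f, hf⟩ := this (Fintype.card V)
    have := hf.le_card
    omega
  obtain ⟨r, f, hr, hf, hmax⟩ := hex
  obtain ⟨hodd, ⟨c₀, hc₀⟩, -⟩ := h.pairPath_max hd hr hmax hf
  have hr3 : 3 ≤ r := by omega
  obtain ⟨F, hF⟩ : ∃ F : ℕ → V, F = fun i => f (i % r) := ⟨_, rfl⟩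
  have hinj : ∀ i j, F i = F j → i % r = j % r := by
    intro i j e
    rw [hF] at e
    exact hf.1 _ (Nat.mod_lt _ (by omega)) _ (Nat.mod_lt _ (by omega)) e
  have hcong : ∀ i j, i % r = j % r → F i = F j := by
    intro i j e
    simp only [hF, e]
  have hP : ∀ i, ∃ c, PairOut G A₀ c (F i) (F (i + 1)) := by
    intro i
    have hi : i % r < r := Nat.mod_lt _ (by omega)
    by_cases hlt : i % r + 1 < r
    · have e : (i + 1) % r = i % r + 1 := by
        rw [Nat.add_mod, Nat.mod_eq_of_lt (by omega : 1 < r), Nat.mod_eq_of_lt hlt]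
      simp only [hF, e]
      exact hf.2 _ hlt
    · have e : (i + 1) % r = 0 := by
        rw [Nat.add_mod, Nat.mod_eq_of_lt (by omega : 1 < r), show i % r + 1 = r by omega,
          Nat.mod_self]
      have e' : i % r = r - 1 := by omega
      simp only [hF, e, e']
      exact ⟨c₀, hc₀.symm⟩
  have hwin : ∀ s a b, a < r → b < r → F (s + a) = F (s + b) → a = b := by
    intro s a b ha hb e
    have := Nat.ModEq.add_left_cancel' s (hinj _ _ e)
    rw [Nat.ModEq, Nat.mod_eq_of_lt ha, Nat.mod_eq_of_lt hb] at this
    exact this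
  have hrot : ∀ s, PairPath G A₀ r (fun i => F (s + i)) := by
    intro s
    exact ⟨fun a ha b hb e => hwin s a b ha hb e, fun i _ => hP (s + i)⟩
  have hnb : ∀ c z, PairOut G A₀ c (F 1) z → z = F 0 ∨ z = F 2 := by
    intro c z hz
    rcases (h.pairPath_max hd hr hmax (hrot 1)).2.2 c z hz with e | e
    · right; exact e
    · left
      rw [e]
      apply hcong
      rw [show 1 + (r - 1) = r by omega]
      simp
  obtain ⟨j, hj⟩ : ∃ j, r = 2 * j + 3 := ⟨(r - 3) / 2, by omega⟩
  have hpath := fun s => h.exists_pairOut_path (fun i => F (s + i)) j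
    (fun a ha b hb e => hwin s a b (by omega) (by omega) e) (fun i _ => hP (s + i))
  obtain ⟨l0, hl0⟩ := hP 0
  obtain ⟨l1, hl1⟩ := hP 1
  obtain ⟨l2, hl2⟩ := hP (r - 1)
  have e0 : F (r - 1 + 1) = F 0 := hcong _ _ (by rw [show r - 1 + 1 = r by omega]; simp)
  rw [e0] at hl2
  have hne02 : F 0 ≠ F 2 := by
    intro e
    have := hwin 0 0 2 (by omega) (by omega) (by simpa using e)
    omega
  obtain ⟨w, hw0, hw2, hwA, hw, hx0, hall⟩ := h.exists_third_of_pairOut hd hl0.symm hl1 hne02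
    (fun z c => hnb c z)
  have hmemX : ∀ s a, a < 2 * j + 2 → F (s + a) ∈
      A₀ ∪ (Finset.range (2 * j + 2)).image (fun i => F (s + i)) := by
    intro s a ha
    exact Finset.mem_union_right _ (Finset.mem_image.2 ⟨a, by simpa using ha, rfl⟩)
  by_cases hwX : w ∈ A₀ ∪ (Finset.range (2 * j + 2)).image (fun i => F (1 + i))
  · obtain ⟨m, hm, rfl⟩ : ∃ m < 2 * j + 2, F (1 + m) = w := by
      simpa [hwA] using hwX
    have hm0 : m ≠ 0 := by
      rintro rfl
      exact hw.ne rfl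
    have hm1 : m ≠ 1 := by
      rintro rfl
      exact hw2 rfl
    obtain ⟨t, ht2, ht4, htm⟩ : ∃ t, 2 ≤ t ∧ t ≤ 3 ∧ t ≠ m := by
      by_cases h2 : m = 2
      · exact ⟨3, by omega, by omega, by omega⟩
      · exact ⟨2, by omega, by omega, by omega⟩
    -- leave out `F (1 + t)`
    have hF1 : ∀ a, a < r → a ≠ t → F (1 + a) ∈
        A₀ ∪ (Finset.range (2 * j + 2)).image (fun i => F (t + 2 + i)) := by
      intro a ha hat
      rcases Nat.lt_or_ge a t with hlt | hge
      · have := hmemX (t + 2) (a + r - t - 1) (by omega)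
        rwa [hcong (t + 2 + (a + r - t - 1)) (1 + a) (by
          rw [show t + 2 + (a + r - t - 1) = 1 + a + r by omega]; simp)] at this
      · have := hmemX (t + 2) (a - t - 1) (by omega)
        rwa [show t + 2 + (a - t - 1) = 1 + a by omega] at this
    obtain ⟨i, -, hi⟩ := (hpath (t + 2)).2 (F 1) (hF1 0 (by omega) (by omega)) (by
      intro v hv
      rcases hall v hv with h1 | rfl | rfl | rfl
      · exact Finset.mem_union_left _ h1
      · have := hF1 (r - 1) (by omega) (by omega)
        rwa [hcong (1 + (r - 1)) 0 (by rw [show 1 + (r - 1) = r by omega]; simp)] at this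
      · exact hF1 1 (by omega) (by omega)
      · exact hF1 m (by omega) (by omega)) (fun hA => absurd hA hl1.left.2)
    exact hl1.left.2 hi.1
  · have h0X : F 0 ∉ A₀ ∪ (Finset.range (2 * j + 2)).image (fun i => F (1 + i)) := by
      simp only [Finset.mem_union, Finset.mem_image, Finset.mem_range, not_or, not_exists, not_and]
      refine ⟨hl0.left.2, fun i hi e => ?_⟩
      have := hwin 0 (1 + i) 0 (by omega) (by omega) (by simpa using e)
      omega
    have hlne : l0 ≠ l2 := by
      rintro rfl
      rcases (hl2.2.2 _).1 hl0.right with e | e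
      · have := hwin 0 1 (r - 1) (by omega) (by omega) (by simpa using e)
        omega
      · have := hwin 0 1 0 (by omega) (by omega) (by simpa using e)
        omega
    refine h.contra 2 2 {l0, l2} (hpath 1).1 (b := F 1) (hmemX 1 0 (by omega))
      (two_le_card_out hx0 h0X hw hwX hw0.symm) (by norm_num) ?_ ?_
      (by rw [Finset.card_pair hlne]) (by norm_num)
    · simp only [Finset.mem_insert, Finset.mem_singleton, not_or]
      constructor
      · rintro e
        exact hl1.left.2 (e ▸ hl0.1)
      · rintro e
        exact hl1.left.2 (e ▸ hl2.1)
    · simp only [Finset.mem_insert, Finset.mem_singleton, forall_eq_or_imp, forall_eq]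
      refine ⟨⟨Or.inl (Finset.mem_union_left _ hl0.1), fun v hv => ?_,
        fun _ => ⟨F 0, hl0.left.1, h0X⟩⟩, ⟨Or.inl (Finset.mem_union_left _ hl2.1), fun v hv => ?_,
        fun _ => ⟨F 0, hl2.right.1, h0X⟩⟩⟩
      · by_cases hvA : v ∈ A₀
        · exact Or.inl (Finset.mem_union_left _ hvA)
        · rcases (hl0.2.2 v).1 ⟨hv, hvA⟩ with rfl | rfl
          · exact Or.inr hx0
          · exact Or.inl (hmemX 1 0 (by omega))
      · by_cases hvA : v ∈ A₀
        · exact Or.inl (Finset.mem_union_left _ hvA)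
        · rcases (hl2.2.2 v).1 ⟨hv, hvA⟩ with rfl | rfl
          · have := hmemX 1 (r - 2) (by omega)
            rw [show 1 + (r - 2) = r - 1 by omega] at this
            exact Or.inl this
          · exact Or.inr hx0

/-- A growth process on a graph of minimum degree at least `5` in which every initially covered
vertex has at most one uncovered neighbour. -/
structure ThinGrowth (G : SimpleGraph V) [DecidableRel G.Adj] (A₀ : Finset V)
    (St : Finset V → ℤ → Prop) : Prop extends Growth G A₀ St where
  deg : ∀ v, 5 ≤ (G.neighborFinset v).card
  single : ∀ {c x w : V}, c ∈ A₀ → x ∉ A₀ → w ∉ A₀ → G.Adj c x → G.Adj c w → w = x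

theorem Growth.thin (h : Growth G A₀ St) (hd : ∀ v, 5 ≤ (G.neighborFinset v).card) :
    ThinGrowth G A₀ St where
  toGrowth := h
  deg := hd
  single := by
    intro c x w hc hx hw hcx hcw
    by_contra hne
    have h2 := h.card_out_le h.base hc (by norm_num)
    obtain ⟨p, q, hpq, e⟩ := exists_pair_of_card_out
      (le_antisymm h2 (two_le_card_out hcx hx hcw hw (Ne.symm hne)))
    exact h.not_pairOut hd ⟨hc, hpq, e⟩

namespace ThinGrowth

theorem enter (h : ThinGrowth G A₀ St) {x c : V} (hx : x ∉ A₀) (hc : c ∈ A₀) (hcx : G.Adj c x) :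
    St (insert x A₀) (5 - (G.neighborFinset x ∩ A₀).card) := by
  have hcK : c ∈ G.neighborFinset x ∩ A₀ := by simp [hc, hcx.symm]
  have hcard := Finset.card_erase_of_mem hcK
  have hpos : 1 ≤ (G.neighborFinset x ∩ A₀).card := Finset.card_pos.2 ⟨c, hcK⟩
  refine h.expand_to 1 ((G.neighborFinset x ∩ A₀).card - 1) ((G.neighborFinset x ∩ A₀).erase c)
    h.base hc (one_le_card_out hcx hx) le_rfl (by simp) ?_ hcard.ge ?_ (by omega)
  · intro v hv
    simp only [Finset.mem_erase, Finset.mem_inter, mem_neighborFinset] at hv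
    refine ⟨Or.inl hv.2.2, fun w hw => ?_, fun _ => ⟨x, hv.2.1.symm, hx⟩⟩
    by_cases hwA : w ∈ A₀
    · exact Or.inl hwA
    · rw [h.single hv.2.2 hx hwA hv.2.1.symm hw]
      exact Or.inr hcx
  · intro v
    rw [Finset.mem_insert]
    constructor
    · rintro (rfl | h)
      · exact Or.inr hcx
      · exact Or.inl h
    · rintro (h1 | h1)
      · exact Or.inr h1
      · by_cases hv : v ∈ A₀
        · exact Or.inr hv
        · exact Or.inl (h.single hc hx hv hcx h1)

theorem card_le_four (h : ThinGrowth G A₀ St) {x c : V} (hx : x ∉ A₀) (hc : c ∈ A₀)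
    (hcx : G.Adj c x) : (G.neighborFinset x ∩ A₀).card ≤ 4 := by
  have := h.pos (h.enter hx hc hcx) (by
    intro e
    exact hx (e ▸ Finset.mem_insert_self x A₀))
  omega

theorem sdiff_insert_self {x : V} (A : Finset V) :
    G.neighborFinset x \ insert x A = G.neighborFinset x \ A := by
  ext w
  simp only [Finset.mem_sdiff, mem_neighborFinset, Finset.mem_insert, not_or]
  exact ⟨fun h => ⟨h.1, h.2.2⟩, fun h => ⟨h.1, h.1.ne', h.2⟩⟩

theorem card_cases (h : ThinGrowth G A₀ St) {x c : V} (hx : x ∉ A₀) (hc : c ∈ A₀)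
    (hcx : G.Adj c x) :
    ((G.neighborFinset x ∩ A₀).card = 2 ∧ (G.neighborFinset x \ A₀).card = 3) ∨
    ((G.neighborFinset x ∩ A₀).card = 3 ∧ (G.neighborFinset x \ A₀).card = 2) ∨
    ((G.neighborFinset x ∩ A₀).card = 4 ∧ (G.neighborFinset x \ A₀).card = 2) ∨
    ((G.neighborFinset x ∩ A₀).card = 4 ∧ (G.neighborFinset x \ A₀).card = 1) := by
  have h4 := h.card_le_four hx hc hcx
  have h3 := Finset.card_sdiff_add_card_inter (G.neighborFinset x) A₀
  have hd := h.deg x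
  by_contra hcon
  refine h.contra (G.neighborFinset x \ A₀).card 0 ∅ (h.enter hx hc hcx) (b := x) (by simp)
    (by rw [sdiff_insert_self]) (by omega) (by simp) (by simp) (by simp) (by omega)

theorem two_le_card_inter (h : ThinGrowth G A₀ St) {x c : V} (hx : x ∉ A₀) (hc : c ∈ A₀)
    (hcx : G.Adj c x) : 2 ≤ (G.neighborFinset x ∩ A₀).card := by
  have := h.card_cases hx hc hcx
  omega

theorem not_adj_of_contra (h : ThinGrowth G A₀ St) {A : Finset V} {t : ℤ} {b z : V} (m s : ℕ)
    (T : Finset V) (hA : St A t) (hb : b ∈ A) (hm : m ≤ (G.neighborFinset b \ A).card)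
    (hm1 : 1 ≤ m) (hbT : b ∉ T) (hT : ∀ v ∈ T, NewlySaturated G A b v) (hs : s ≤ T.card)
    (ht : t + 7 - 3 * m - s - 2 ≤ 0) (hbA : b ∉ A₀) (hTA : ∀ v ∈ T, v ∉ A₀) (hz : z ∉ A)
    (hbz : G.Adj b z) : ∀ c ∈ A₀, ¬ G.Adj z c := by
  intro c hc hzc
  have hz0 : z ∉ A₀ := fun hz0 => hz (h.subset hA hz0)
  have h2 := h.two_le_card_inter hz0 hc hzc.symm
  have hdisj : Disjoint T (G.neighborFinset z ∩ A₀) := by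
    rw [Finset.disjoint_left]
    intro v hv hv'
    exact hTA v hv (Finset.mem_inter.1 hv').2
  refine h.contra m (s + 2) (T ∪ (G.neighborFinset z ∩ A₀)) hA hb hm hm1 ?_ ?_
    (by rw [Finset.card_union_of_disjoint hdisj]; omega) (by push_cast; omega)
  · simp [hbT, hbA]
  · intro v hv
    rcases Finset.mem_union.1 hv with hv | hv
    · exact hT v hv
    · simp only [Finset.mem_inter, mem_neighborFinset] at hv
      refine ⟨Or.inl (h.subset hA hv.2), fun w hw => ?_, fun _ => ⟨z, hv.1.symm, hz⟩⟩
      by_cases hwA : w ∈ A₀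
      · exact Or.inl (h.subset hA hwA)
      · rw [h.single hv.2 hz0 hwA hv.1.symm hw]
        exact Or.inr hbz

/-- No vertex outside `A₀` has exactly one neighbour outside `A₀` and a neighbour in `A₀`. -/
theorem card_out_ne_one (h : ThinGrowth G A₀ St) {x c : V} (hx : x ∉ A₀) (hc : c ∈ A₀)
    (hcx : G.Adj c x) : (G.neighborFinset x \ A₀).card ≠ 1 := by
  intro h1
  have hk : (G.neighborFinset x ∩ A₀).card = 4 := by
    have := h.card_cases hx hc hcx
    omega
  obtain ⟨y, hy⟩ := Finset.card_eq_one.1 h1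
  have hxy : ∀ w, (G.Adj x w ∧ w ∉ A₀) ↔ w = y := by
    intro w
    have := congrArg (w ∈ ·) hy
    simpa using this
  obtain ⟨hxy1, hyA⟩ := (hxy y).2 rfl
  by_cases hyK : ∃ c' ∈ A₀, G.Adj y c'
  · obtain ⟨c', hc', hyc'⟩ := hyK
    have hcc := h.card_cases hyA hc' hyc'.symm
    -- enter through `y`, then saturate `K x` and `x` as well
    have hdisj : x ∉ G.neighborFinset x ∩ A₀ := by simp
    refine h.contra (G.neighborFinset y \ A₀).card 5 (insert x (G.neighborFinset x ∩ A₀))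
      (h.enter hyA hc' hyc'.symm) (b := y) (by simp) (by rw [sdiff_insert_self]) (by omega) ?_ ?_
      (by rw [Finset.card_insert_of_notMem hdisj]; omega) (by push_cast; omega)
    · simp [hyA, hxy1.ne']
    · intro v hv
      rcases Finset.mem_insert.1 hv with rfl | hv
      · refine ⟨Or.inr hxy1.symm, fun w hw => ?_, fun hvA => ?_⟩
        · left
          by_cases hwA : w ∈ A₀
          · simp [hwA]
          · simp [(hxy w).1 ⟨hw, hwA⟩]
        · simp [hx, hxy1.ne] at hvA
      · simp only [Finset.mem_inter, mem_neighborFinset] at hv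
        refine ⟨Or.inl (by simp [hv.2]), fun w hw => ?_, fun _ => ⟨x, hv.1.symm, by simp [hx, hxy1.ne]⟩⟩
        by_cases hwA : w ∈ A₀
        · simp [hwA]
        · rw [h.single hv.2 hx hwA hv.1.symm hw]
          exact Or.inr hxy1.symm
  · push Not at hyK
    have hS : St (insert y (insert x A₀)) 5 := by
      refine h.expand_to 1 0 ∅ (h.enter hx hc hcx) (b := x) (by simp)
        (by rw [sdiff_insert_self]; omega) le_rfl (by simp) (by simp) (by simp) ?_ (by rw [hk]; norm_num)
      intro v
      have := hxy v
      grind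
    refine h.contra 4 0 ∅ hS (b := y) (by simp) ?_ (by norm_num) (by simp) (by simp) (by simp)
      (by norm_num)
    refine le_card_out (B := {x}) (h.deg y) ?_ (by simp)
    intro w hw hwA
    have := hyK w
    have := hw.ne
    grind

end ThinGrowth

theorem three_le_card_out {A : Finset V} {b x y z : V} (hx : G.Adj b x) (hxA : x ∉ A)
    (hy : G.Adj b y) (hyA : y ∉ A) (hz : G.Adj b z) (hzA : z ∉ A) (hxy : x ≠ y) (hxz : x ≠ z)
    (hyz : y ≠ z) : 3 ≤ (G.neighborFinset b \ A).card := by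
  rw [← Finset.card_eq_three.2 ⟨x, y, z, hxy, hxz, hyz, rfl⟩]
  apply Finset.card_le_card
  intro w hw
  simp only [Finset.mem_insert, Finset.mem_singleton] at hw
  rcases hw with rfl | rfl | rfl <;> simp [*]

namespace ThinGrowth

theorem three_le_out (h : ThinGrowth G A₀ St) {A : Finset V} {z p q : V}
    (hB : ∀ w, G.Adj z w → w ∈ A → w = p ∨ w = q) : 3 ≤ (G.neighborFinset z \ A).card :=
  le_card_out (B := {p, q}) (h.deg z) (by simpa using hB)
    (by have := Finset.card_le_two (a := p) (b := q); omega)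

theorem two_le_out (h : ThinGrowth G A₀ St) {A : Finset V} {z p q r : V}
    (hB : ∀ w, G.Adj z w → w ∈ A → w = p ∨ w = q ∨ w = r) :
    2 ≤ (G.neighborFinset z \ A).card :=
  le_card_out (B := {p, q, r}) (h.deg z) (by simpa using hB)
    (by have := Finset.card_le_three (a := p) (b := q) (c := r); omega)

/-- In a state with loss at most `2` a covered vertex has at least three covered neighbours. -/
theorem false_of_covered (h : ThinGrowth G A₀ St) {A : Finset V} {t : ℤ} {z p q : V}
    (hA : St A t) (hz : z ∈ A) (ht : t ≤ 2) (hB : ∀ w, G.Adj z w → w ∈ A → w = p ∨ w = q) :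
    False := by
  have := h.three_le_out hB
  have := h.card_out_le hA hz ht
  omega

theorem false_of_out (h : ThinGrowth G A₀ St) {A : Finset V} {t : ℤ} {b x y z : V}
    (hA : St A t) (hb : b ∈ A) (ht : t ≤ 2) (hx : G.Adj b x) (hxA : x ∉ A)
    (hy : G.Adj b y) (hyA : y ∉ A) (hz : G.Adj b z) (hzA : z ∉ A) (hxy : x ≠ y) (hxz : x ≠ z)
    (hyz : y ≠ z) : False := by
  have := three_le_card_out hx hxA hy hyA hz hzA hxy hxz hyz
  have := h.card_out_le hA hb ht
  omega

theorem exists_outs (h : ThinGrowth G A₀ St) {A : Finset V} {t : ℤ} {z p q r : V}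
    (hA : St A t) (hz : z ∈ A) (ht : t ≤ 2)
    (hB : ∀ w, G.Adj z w → w ∈ A → w = p ∨ w = q ∨ w = r) :
    ∃ x y, x ≠ y ∧ ∀ w, (G.Adj z w ∧ w ∉ A) ↔ w = x ∨ w = y :=
  exists_pair_of_card_out (le_antisymm (h.card_out_le hA hz ht) (h.two_le_out hB))

/-- Expanding a vertex with exactly two uncovered neighbours. -/
theorem expand_two (h : ThinGrowth G A₀ St) {A : Finset V} {t t' : ℤ} {b x y : V}
    (T : Finset V) (hA : St A t) (hb : b ∈ A) (hxy : x ≠ y)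
    (ho : ∀ w, (G.Adj b w ∧ w ∉ A) ↔ w = x ∨ w = y) (hbT : b ∉ T)
    (hT : ∀ v ∈ T, NewlySaturated G A b v) (ht : t + 1 - T.card ≤ t') :
    St (insert x (insert y A)) t' := by
  have hx := (ho x).2 (Or.inl rfl)
  have hy := (ho y).2 (Or.inr rfl)
  refine h.expand_to 2 T.card T hA hb (two_le_card_out hx.1 hx.2 hy.1 hy.2 hxy) (by norm_num) hbT
    hT le_rfl ?_ (by push_cast; omega)
  intro v
  have := ho v
  grind

theorem contra_two (h : ThinGrowth G A₀ St) {A : Finset V} {t : ℤ} {b x y : V}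
    (T : Finset V) (hA : St A t) (hb : b ∈ A) (hxy : x ≠ y)
    (hx : G.Adj b x) (hxA : x ∉ A) (hy : G.Adj b y) (hyA : y ∉ A) (hbT : b ∉ T)
    (hT : ∀ v ∈ T, NewlySaturated G A b v) (ht : t + 1 - T.card ≤ 0) : False :=
  h.contra 2 T.card T hA hb (two_le_card_out hx hxA hy hyA hxy) (by norm_num) hbT hT le_rfl
    (by push_cast; omega)

theorem not_adj_two (h : ThinGrowth G A₀ St) {A : Finset V} {t : ℤ} {b x y : V}
    (T : Finset V) (hA : St A t) (hb : b ∈ A) (hxy : x ≠ y)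
    (hx : G.Adj b x) (hxA : x ∉ A) (hy : G.Adj b y) (hyA : y ∉ A) (hbT : b ∉ T)
    (hT : ∀ v ∈ T, NewlySaturated G A b v) (ht : t - 1 - T.card ≤ 0) (hbA : b ∉ A₀)
    (hTA : ∀ v ∈ T, v ∉ A₀) : ∀ c ∈ A₀, ¬ G.Adj x c :=
  h.not_adj_of_contra 2 T.card T hA hb (two_le_card_out hx hxA hy hyA hxy) (by norm_num) hbT hT
    le_rfl (by push_cast; omega) hbA hTA hxA hx

theorem tri_out (h : ThinGrowth G A₀ St) {A : Finset V} {x y₁ y₂ y₃ z z' : V}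
    (hSt : St A 1) (hA : ∀ v, v ∈ A ↔ v ∈ A₀ ∨ v = x ∨ v = y₁ ∨ v = y₂ ∨ v = y₃)
    (hx : ∀ w, G.Adj x w → w ∈ A) (hy : y₁ ∉ A₀) (hzz : z ≠ z')
    (ho : ∀ w, (G.Adj y₁ w ∧ w ∉ A) ↔ w = z ∨ w = z') :
    (G.Adj z y₂ ∨ G.Adj z y₃) ∧ (G.Adj z y₂ ∧ G.Adj z y₃ ∨ G.Adj z z') := by
  have hz := (ho z).2 (by simp)
  have hz' := (ho z').2 (by simp)
  have h0 : ∀ c ∈ A₀, ¬ G.Adj z c := h.not_adj_two ∅ hSt (by simp [hA]) hzz hz.1 hz.2 hz'.1 hz'.2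
    (by simp) (by simp) (by simp) hy (by simp)
  have hS : St (insert z (insert z' A)) 2 :=
    h.expand_two ∅ hSt (by simp [hA]) hzz ho (by simp) (by simp) (by simp)
  have hzx : ¬ G.Adj z x := fun hadj => hz.2 (hx z hadj.symm)
  have key : ∀ p q, (∀ w, G.Adj z w → w = y₁ ∨ w = y₂ ∨ w = y₃ ∨ w = z' → w = p ∨ w = q) →
      False := by
    intro p q hpq
    refine h.false_of_covered (p := p) (q := q) hS (z := z) (by simp) le_rfl ?_
    intro w hw hwA
    have := hw.ne
    have := h0 w
    have := hA w
    grind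
  have k1 := key y₁ z'
  have k2 := key y₁ y₂
  have k3 := key y₁ y₃
  grind

theorem tri_ne (h : ThinGrowth G A₀ St) {A : Finset V} {x y₁ y₂ y₃ a b c d : V}
    (hSt : St A 1) (hA : ∀ v, v ∈ A ↔ v ∈ A₀ ∨ v = x ∨ v = y₁ ∨ v = y₂ ∨ v = y₃)
    (hx : ∀ w, G.Adj x w → w ∈ A) (hy3 : y₃ ∉ A₀) (h12 : y₁ ≠ y₂) (h13 : y₁ ≠ y₃)
    (h23 : y₂ ≠ y₃) (hab : a ≠ b) (hcd : c ≠ d)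
    (ho1 : ∀ w, (G.Adj y₁ w ∧ w ∉ A) ↔ w = a ∨ w = b)
    (ho2 : ∀ w, (G.Adj y₂ w ∧ w ∉ A) ↔ w = a ∨ w = b)
    (ho3 : ∀ w, (G.Adj y₃ w ∧ w ∉ A) ↔ w = c ∨ w = d) : False := by
  have hA' : ∀ v, v ∈ A ↔ v ∈ A₀ ∨ v = x ∨ v = y₃ ∨ v = y₁ ∨ v = y₂ := by
    intro v; rw [hA]; tauto
  have kc := (h.tri_out hSt hA' hx hy3 hcd ho3).1
  have kd := (h.tri_out hSt hA' hx hy3 hcd.symm (fun w => by rw [ho3, or_comm])).1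
  have hc := (ho3 c).2 (by simp)
  have hd := (ho3 d).2 (by simp)
  have hc' : c = a ∨ c = b := by
    have := ho1 c
    have := ho2 c
    have := G.adj_comm c y₁
    have := G.adj_comm c y₂
    grind
  have hd' : d = a ∨ d = b := by
    have := ho1 d
    have := ho2 d
    have := G.adj_comm d y₁
    have := G.adj_comm d y₂
    grind
  have ha := (ho1 a).2 (by simp)
  have hb := (ho1 b).2 (by simp)
  have ha2 := (ho2 a).2 (by simp)
  have ha3 := (ho3 a).2 (by grind)
  refine h.contra_two {y₂, y₃} hSt (by simp [hA]) hab ha.1 ha.2 hb.1 hb.2 (by simp [h12, h13]) ?_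
    (by rw [Finset.card_pair h23]; norm_num)
  simp only [Finset.mem_insert, Finset.mem_singleton, forall_eq_or_imp, forall_eq]
  refine ⟨⟨Or.inl (by simp [hA]), fun w hw => ?_, fun _ => ⟨a, ha2⟩⟩,
    ⟨Or.inl (by simp [hA]), fun w hw => ?_, fun _ => ⟨a, ha3⟩⟩⟩
  · have := ho1 w
    have := ho2 w
    grind
  · have := ho1 w
    have := ho3 w
    grind

theorem tri_final (h : ThinGrowth G A₀ St) {A : Finset V} {x y₁ y₂ y₃ z₁ z₂ z₃ : V}
    (hSt : St A 1) (hA : ∀ v, v ∈ A ↔ v ∈ A₀ ∨ v = x ∨ v = y₁ ∨ v = y₂ ∨ v = y₃)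
    (hx : ∀ w, G.Adj x w → w ∈ A) (hy1 : y₁ ∉ A₀) (hy2 : y₂ ∉ A₀) (hy3 : y₃ ∉ A₀)
    (h23 : y₂ ≠ y₃) (hz12 : z₁ ≠ z₂)
    (hz13 : z₁ ≠ z₃) (hz23 : z₂ ≠ z₃)
    (ho1 : ∀ w, (G.Adj y₁ w ∧ w ∉ A) ↔ w = z₁ ∨ w = z₂)
    (ho2 : ∀ w, (G.Adj y₂ w ∧ w ∉ A) ↔ w = z₁ ∨ w = z₃)
    (ho3 : ∀ w, (G.Adj y₃ w ∧ w ∉ A) ↔ w = z₂ ∨ w = z₃) : False := by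
  have hA2 : ∀ v, v ∈ A ↔ v ∈ A₀ ∨ v = x ∨ v = y₂ ∨ v = y₃ ∨ v = y₁ := by
    intro v; rw [hA]; tauto
  have hA3 : ∀ v, v ∈ A ↔ v ∈ A₀ ∨ v = x ∨ v = y₃ ∨ v = y₁ ∨ v = y₂ := by
    intro v; rw [hA]; tauto
  have hz1 := (ho1 z₁).2 (by simp)
  have hz2 := (ho1 z₂).2 (by simp)
  have hz3 := (ho2 z₃).2 (by simp)
  have n13 : ¬ G.Adj z₁ y₃ := fun e => by
    have := (ho3 z₁).1 ⟨e.symm, hz1.2⟩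
    grind
  have n22 : ¬ G.Adj z₂ y₂ := fun e => by
    have := (ho2 z₂).1 ⟨e.symm, hz2.2⟩
    grind
  have e12 : G.Adj z₁ z₂ := by
    have := (h.tri_out hSt hA hx hy1 hz12 ho1).2
    grind
  have e13 : G.Adj z₁ z₃ := by
    have := (h.tri_out hSt hA2 hx hy2 hz13 ho2).2
    grind
  have e23 : G.Adj z₂ z₃ := by
    have := (h.tri_out hSt hA3 hx hy3 hz23 ho3).2
    grind
  have h0 : ∀ c ∈ A₀, ¬ G.Adj z₁ c := h.not_adj_two ∅ hSt (b := y₁) (by simp [hA]) hz12 hz1.1 hz1.2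
    hz2.1 hz2.2 (by simp) (by simp) (by simp) hy1 (by simp)
  have hS : St (insert z₁ (insert z₂ A)) 2 :=
    h.expand_two ∅ hSt (b := y₁) (by simp [hA]) hz12 ho1 (by simp) (by simp) (by simp)
  have hS' : St (insert z₁ (insert z₃ A)) 2 :=
    h.expand_two ∅ hSt (b := y₂) (by simp [hA]) hz13 ho2 (by simp) (by simp) (by simp)
  have hz1x : ¬ G.Adj z₁ x := fun hadj => hz1.2 (hx _ hadj.symm)
  obtain ⟨p, q, hpq, hoz⟩ := h.exists_outs (z := z₁) (p := y₁) (q := y₂) (r := z₂) hS (by simp)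
    le_rfl (by
      intro w hw hwA
      have := h0 w
      have := hA w
      have := hw.ne
      grind)
  obtain ⟨p, hpz, hoz⟩ : ∃ p, z₃ ≠ p ∧ ∀ w, (G.Adj z₁ w ∧ w ∉ insert z₁ (insert z₂ A)) ↔
      w = z₃ ∨ w = p := by
    have : z₃ = p ∨ z₃ = q := (hoz z₃).1 ⟨e13, by grind⟩
    rcases this with rfl | rfl
    · exact ⟨q, hpq, hoz⟩
    · exact ⟨p, hpq.symm, fun w => by rw [hoz, or_comm]⟩
  have hp := (hoz p).2 (by simp)
  have hpA : p ∉ A ∧ p ≠ z₁ ∧ p ≠ z₂ := by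
    have := hp.2
    simp only [Finset.mem_insert, not_or] at this
    tauto
  have hz3A : z₃ ∉ insert z₁ (insert z₂ A) := ((hoz z₃).2 (by simp)).2
  have hT : ∀ v ∈ ({y₂, y₃} : Finset V), NewlySaturated G (insert z₁ (insert z₂ A)) z₁ v := by
    simp only [Finset.mem_insert, Finset.mem_singleton, forall_eq_or_imp, forall_eq]
    refine ⟨⟨Or.inl (by simp [hA]), fun w hw => ?_, fun _ => ⟨z₃, hz3.1, hz3A⟩⟩,
      ⟨Or.inl (by simp [hA]), fun w hw => ?_, fun _ => ⟨z₃, ((ho3 z₃).2 (by simp)).1, hz3A⟩⟩⟩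
    · have := ho2 w
      grind
    · have := ho3 w
      grind
  have hbT : z₁ ∉ ({y₂, y₃} : Finset V) := by
    have := hA z₁
    grind
  have hpK : ∀ c ∈ A₀, ¬ G.Adj p c := by
    refine h.not_adj_two {y₂, y₃} hS (by simp) hpz.symm hp.1 hp.2 e13 hz3A hbT hT
      (by rw [Finset.card_pair h23]; norm_num) (by grind) (by simp [hy2, hy3])
  have hS4 : St (insert z₃ (insert p (insert z₁ (insert z₂ A)))) 1 :=
    h.expand_two {y₂, y₃} hS (by simp) hpz hoz hbT hT (by rw [Finset.card_pair h23]; norm_num)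
  have cz : ∀ u, u = z₂ ∨ u = z₃ → (∀ w, G.Adj u w → w ∈ insert z₁ (insert z₂ A) ∨ G.Adj z₁ w) →
      False := by
    intro u hu hus
    refine h.contra_two {y₂, y₃, u} hS (by simp) hpz e13 hz3A hp.1 hp.2 ?_ ?_ ?_
    · grind
    · intro v hv
      have hv' : v ∈ ({y₂, y₃} : Finset V) ∨ v = u := by grind
      rcases hv' with hv' | rfl
      · exact hT v hv'
      · refine ⟨by grind, hus, fun hA => ⟨z₃, by grind, hz3A⟩⟩
    · have : u ∉ ({y₂, y₃} : Finset V) := by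
        have := hA u
        grind
      rw [show ({y₂, y₃, u} : Finset V) = insert u {y₂, y₃} by grind,
        Finset.card_insert_of_notMem this, Finset.card_pair h23]
      norm_num
  have hpz2 : ¬ G.Adj z₂ p := by
    intro e
    refine cz z₂ (Or.inl rfl) fun w hw => ?_
    by_contra hc
    push Not at hc
    refine h.false_of_out hS (b := z₂) (by simp) le_rfl e23 hz3A e hp.2 hw hc.1 hpz ?_ ?_
    · rintro rfl; exact hc.2 e13
    · rintro rfl; exact hc.2 hp.1
  have hpz3 : ¬ G.Adj z₃ p := by
    intro e
    refine cz z₃ (Or.inr rfl) fun w hw => ?_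
    by_contra hc
    push Not at hc
    refine h.false_of_out hS' (b := z₃) (x := z₂) (y := p) (z := w) (by simp) le_rfl e23.symm
      (by grind) e (by grind) hw (by
        have := hw.ne
        grind) (by grind) (by grind) ?_
    rintro rfl; exact hc.2 hp.1
  refine h.false_of_covered (p := z₁) (q := z₁) hS4 (z := p) (by simp) (by norm_num) ?_
  intro w hw hwA
  have := hpK w
  have := hw.ne
  have := hA w
  have := hx p
  have := ho1 p
  have := ho2 p
  have := ho3 p
  have := G.adj_comm p w
  grind

theorem card_out_ne_three (h : ThinGrowth G A₀ St) {x c : V} (hx : x ∉ A₀) (hc : c ∈ A₀)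
    (hcx : G.Adj c x) : (G.neighborFinset x \ A₀).card ≠ 3 := by
  intro h3
  have hk : (G.neighborFinset x ∩ A₀).card = 2 := by
    have := h.card_cases hx hc hcx
    omega
  have hS1 := h.enter hx hc hcx
  rw [hk] at hS1
  have h3' : (G.neighborFinset x \ insert x A₀).card = 3 := by rwa [sdiff_insert_self]
  obtain ⟨y₁, y₂, y₃, h12, h13, h23, ho⟩ := exists_triple_of_card_out h3'
  obtain ⟨A, hA⟩ : ∃ A, A = insert y₁ (insert y₂ (insert y₃ (insert x A₀))) := ⟨_, rfl⟩
  have hSt : St A 1 := by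
    refine h.expand_to 3 0 ∅ hS1 (b := x) (by simp) h3'.ge (by norm_num) (by simp) (by simp)
      (by simp) ?_ (by norm_num)
    intro v
    have := ho v
    grind
  have hxA : ∀ w, G.Adj x w → w ∈ A := by
    intro w hw
    have := ho w
    grind
  have hA' : ∀ v, v ∈ A ↔ v ∈ A₀ ∨ v = x ∨ v = y₁ ∨ v = y₂ ∨ v = y₃ := by
    intro v; subst hA; simp; tauto
  have hyA : ∀ y, y = y₁ ∨ y = y₂ ∨ y = y₃ → G.Adj x y ∧ y ∉ A₀ ∧ ∀ c ∈ A₀, ¬ G.Adj y c := by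
    intro y hy
    have h1 := (ho y).2 hy
    refine ⟨h1.1, by grind, ?_⟩
    exact h.not_adj_of_contra 3 0 ∅ hS1 (by simp) h3'.ge (by norm_num) (by simp) (by simp)
      (by simp) (by norm_num) hx (by simp) h1.2 h1.1
  have outs : ∀ y, y = y₁ ∨ y = y₂ ∨ y = y₃ →
      ∃ a b, a ≠ b ∧ ∀ w, (G.Adj y w ∧ w ∉ A) ↔ w = a ∨ w = b := by
    intro y hy
    obtain ⟨k1, k2, k3⟩ := hyA y hy
    have key : ∀ p q, (∀ w, w = y₁ ∨ w = y₂ ∨ w = y₃ → w ≠ y → w = p ∨ w = q) →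
        ∃ a b, a ≠ b ∧ ∀ w, (G.Adj y w ∧ w ∉ A) ↔ w = a ∨ w = b := by
      intro p q hpq
      refine h.exists_outs (p := x) (q := p) (r := q) hSt (by grind) (by norm_num) ?_
      intro w hw hwA
      have := hw.ne
      have := k3 w
      have := hA' w
      have := hpq w
      grind
    rcases hy with rfl | rfl | rfl
    · exact key y₂ y₃ (by grind)
    · exact key y₁ y₃ (by grind)
    · exact key y₁ y₂ (by grind)
  obtain ⟨a, b, hab, o1⟩ := outs y₁ (by simp)
  obtain ⟨c, d, hcd, o2⟩ := outs y₂ (by simp)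
  obtain ⟨e, f, hef, o3⟩ := outs y₃ (by simp)
  have k1 := (hyA y₁ (by simp)).2.1
  have k2 := (hyA y₂ (by simp)).2.1
  have k3 := (hyA y₃ (by simp)).2.1
  have hA2 : ∀ v, v ∈ A ↔ v ∈ A₀ ∨ v = x ∨ v = y₂ ∨ v = y₃ ∨ v = y₁ := by
    intro v; rw [hA']; tauto
  have hA3 : ∀ v, v ∈ A ↔ v ∈ A₀ ∨ v = x ∨ v = y₃ ∨ v = y₁ ∨ v = y₂ := by
    intro v; rw [hA']; tauto
  have swap : ∀ {y a b : V}, (∀ w, (G.Adj y w ∧ w ∉ A) ↔ w = a ∨ w = b) →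
      ∀ w, (G.Adj y w ∧ w ∉ A) ↔ w = b ∨ w = a := fun hh w => by rw [hh, or_comm]
  have t12 : ¬ (∀ w, (w = a ∨ w = b) ↔ (w = c ∨ w = d)) := fun hh =>
    h.tri_ne hSt hA' hxA k3 h12 h13 h23 hab hef o1 (fun w => by rw [o2, hh]) o3
  have t23 : ¬ (∀ w, (w = c ∨ w = d) ↔ (w = e ∨ w = f)) := fun hh =>
    h.tri_ne hSt hA2 hxA k1 h23 h12.symm h13.symm hcd hab o2 (fun w => by rw [o3, hh]) o1
  have t13 : ¬ (∀ w, (w = e ∨ w = f) ↔ (w = a ∨ w = b)) := fun hh =>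
    h.tri_ne hSt hA3 hxA k2 h13.symm h23.symm h12 hef hcd o3 (fun w => by rw [o1, hh]) o2
  have ta : (a = c ∨ a = d) ∨ (a = e ∨ a = f) :=
    (h.tri_out hSt hA' hxA k1 hab o1).1.imp (fun k => (o2 _).1 ⟨k.symm, ((o1 a).2 (by simp)).2⟩)
      (fun k => (o3 _).1 ⟨k.symm, ((o1 a).2 (by simp)).2⟩)
  have tb : (b = c ∨ b = d) ∨ (b = e ∨ b = f) :=
    (h.tri_out hSt hA' hxA k1 hab.symm (swap o1)).1.imp
      (fun k => (o2 _).1 ⟨k.symm, ((o1 b).2 (by simp)).2⟩)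
      (fun k => (o3 _).1 ⟨k.symm, ((o1 b).2 (by simp)).2⟩)
  have tc : (c = e ∨ c = f) ∨ (c = a ∨ c = b) :=
    (h.tri_out hSt hA2 hxA k2 hcd o2).1.imp (fun k => (o3 _).1 ⟨k.symm, ((o2 c).2 (by simp)).2⟩)
      (fun k => (o1 _).1 ⟨k.symm, ((o2 c).2 (by simp)).2⟩)
  have td : (d = e ∨ d = f) ∨ (d = a ∨ d = b) :=
    (h.tri_out hSt hA2 hxA k2 hcd.symm (swap o2)).1.imp
      (fun k => (o3 _).1 ⟨k.symm, ((o2 d).2 (by simp)).2⟩)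
      (fun k => (o1 _).1 ⟨k.symm, ((o2 d).2 (by simp)).2⟩)
  obtain ⟨z₁, z₂, z₃, n12, n13, n23, p1, p2, p3⟩ : ∃ z₁ z₂ z₃ : V, z₁ ≠ z₂ ∧ z₁ ≠ z₃ ∧ z₂ ≠ z₃ ∧
      (∀ w, (w = a ∨ w = b) ↔ (w = z₁ ∨ w = z₂)) ∧ (∀ w, (w = c ∨ w = d) ↔ (w = z₁ ∨ w = z₃)) ∧
      (∀ w, (w = e ∨ w = f) ↔ (w = z₂ ∨ w = z₃)) := by
    by_cases ac : a = c
    · exact ⟨a, b, d, by grind⟩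
    by_cases ad : a = d
    · exact ⟨a, b, c, by grind⟩
    by_cases bc : b = c
    · exact ⟨b, a, d, by grind⟩
    · exact ⟨b, a, c, by grind⟩
  exact h.tri_final hSt hA' hxA k1 k2 k3 h23 n12 n13 n23 (fun w => by rw [o1, p1])
    (fun w => by rw [o2, p2]) (fun w => by rw [o3, p3])

end ThinGrowth

theorem NewlySaturated.of_mem {A : Finset V} {b v u : V} (hv : v ∈ A)
    (hw : ∀ w, G.Adj v w → w ∉ A → G.Adj b w) (hu : G.Adj v u) (huA : u ∉ A) :
    NewlySaturated G A b v :=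
  ⟨Or.inl hv, fun w h => (em (w ∈ A)).imp id (hw w h), fun _ => ⟨u, hu, huA⟩⟩

theorem NewlySaturated.of_not_mem {A : Finset V} {b v : V} (hv : v ∉ A) (hb : G.Adj b v)
    (hw : ∀ w, G.Adj v w → w ∉ A → G.Adj b w) : NewlySaturated G A b v :=
  ⟨Or.inr hb, fun w h => (em (w ∈ A)).imp id (hw w h), fun h => absurd h hv⟩

namespace ThinGrowth

theorem duo_state (h : ThinGrowth G A₀ St) {A : Finset V} {y₁ a b c : V}
    (hSt : St A 3) (hy1 : y₁ ∈ A) (hy0 : y₁ ∉ A₀) (hab : a ≠ b) (hac : a ≠ c) (hbc : b ≠ c)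
    (ho : ∀ w, (G.Adj y₁ w ∧ w ∉ A) ↔ w = a ∨ w = b ∨ w = c) :
    St (insert a (insert b (insert c A))) 1 ∧
      ∀ w, w = a ∨ w = b ∨ w = c → ∀ k ∈ A₀, ¬ G.Adj w k := by
  have ha := (ho a).2 (by simp)
  have hb := (ho b).2 (by simp)
  have hc := (ho c).2 (by simp)
  have h3 := three_le_card_out ha.1 ha.2 hb.1 hb.2 hc.1 hc.2 hab hac hbc
  constructor
  · refine h.expand_to 3 0 ∅ hSt hy1 h3 (by norm_num) (by simp) (by simp) (by simp) ?_
      (by norm_num)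
    intro v
    have := ho v
    grind
  · intro w hw
    have hw' := (ho w).2 hw
    exact h.not_adj_of_contra 3 0 ∅ hSt hy1 h3 (by norm_num) (by simp) (by simp) (by simp)
      (by norm_num) hy0 (by simp) hw'.2 hw'.1

/-- A vertex `c` reached through `y₁` but not through `y₂` is adjacent to the other two vertices
reached through `y₁` and has exactly two further neighbours. -/
theorem duo_out (h : ThinGrowth G A₀ St) {A : Finset V} {x y₁ y₂ a b c : V}
    (hSt : St A 3) (hA : ∀ v, v ∈ A ↔ v ∈ A₀ ∨ v = x ∨ v = y₁ ∨ v = y₂)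
    (hx : ∀ w, G.Adj x w → w ∈ A) (hy1 : y₁ ∉ A₀) (hab : a ≠ b) (hac : a ≠ c) (hbc : b ≠ c)
    (ho : ∀ w, (G.Adj y₁ w ∧ w ∉ A) ↔ w = a ∨ w = b ∨ w = c) (hcy : ¬ G.Adj y₂ c) :
    G.Adj c a ∧ G.Adj c b ∧ ∃ g k, g ≠ k ∧
      ∀ w, (G.Adj c w ∧ w ∉ insert a (insert b (insert c A))) ↔ w = g ∨ w = k := by
  obtain ⟨hS, h0⟩ := h.duo_state hSt (by simp [hA]) hy1 hab hac hbc ho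
  have hcov : ∀ w, G.Adj c w → w ∈ insert a (insert b (insert c A)) → w = y₁ ∨ w = a ∨ w = b := by
    intro w hw hwA
    have := h0 c (by simp) w
    have := hA w
    have := hw.ne
    have := G.adj_comm c w
    have := hx c
    have := (ho c).2 (by simp)
    grind
  refine ⟨?_, ?_, h.exists_outs hS (by simp) (by norm_num) hcov⟩
  · by_contra hn
    refine h.false_of_covered hS (z := c) (p := y₁) (q := b) (by simp) (by norm_num) ?_
    intro w hw hwA
    have := hcov w hw hwA
    grind
  · by_contra hn
    refine h.false_of_covered hS (z := c) (p := y₁) (q := a) (by simp) (by norm_num) ?_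
    intro w hw hwA
    have := hcov w hw hwA
    grind

theorem duo_adj (h : ThinGrowth G A₀ St) {A : Finset V} {x y₁ y₂ a b c d : V}
    (hSt : St A 3) (hA : ∀ v, v ∈ A ↔ v ∈ A₀ ∨ v = x ∨ v = y₁ ∨ v = y₂)
    (hx : ∀ w, G.Adj x w → w ∈ A) (hy1 : y₁ ∉ A₀) (hy2 : y₂ ∉ A₀) (hy : y₁ ≠ y₂)
    (hab : a ≠ b) (hac : a ≠ c) (hbc : b ≠ c) (had : a ≠ d) (hbd : b ≠ d) (hcd : c ≠ d)
    (ho1 : ∀ w, (G.Adj y₁ w ∧ w ∉ A) ↔ w = a ∨ w = b ∨ w = c)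
    (ho2 : ∀ w, (G.Adj y₂ w ∧ w ∉ A) ↔ w = a ∨ w = b ∨ w = d) : ¬ G.Adj c d := by
  intro hadj
  have hA2 : ∀ v, v ∈ A ↔ v ∈ A₀ ∨ v = x ∨ v = y₂ ∨ v = y₁ := by
    intro v; rw [hA]; tauto
  obtain ⟨hS, h0⟩ := h.duo_state hSt (by simp [hA]) hy1 hab hac hbc ho1
  obtain ⟨hS', h0'⟩ := h.duo_state hSt (by simp [hA]) hy2 hab had hbd ho2
  have hc := (ho1 c).2 (by simp)
  have hd := (ho2 d).2 (by simp)
  have hcy : ¬ G.Adj y₂ c := fun e => by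
    have := (ho2 c).1 ⟨e, hc.2⟩
    grind
  have hdy : ¬ G.Adj y₁ d := fun e => by
    have := (ho1 d).1 ⟨e, hd.2⟩
    grind
  obtain ⟨hca, hcb, g, k, hgk, hoc⟩ := h.duo_out hSt hA hx hy1 hab hac hbc ho1 hcy
  obtain ⟨hda, hdb, -⟩ := h.duo_out hSt hA2 hx hy2 hab had hbd ho2 hdy
  have hdB : d ∉ insert a (insert b (insert c A)) := by
    have := hd.2
    grind
  obtain ⟨k, hgk, hoc⟩ : ∃ k, d ≠ k ∧ ∀ w, (G.Adj c w ∧ w ∉ insert a (insert b (insert c A))) ↔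
      w = d ∨ w = k := by
    rcases (hoc d).1 ⟨hadj, hdB⟩ with rfl | rfl
    · exact ⟨k, hgk, hoc⟩
    · exact ⟨g, hgk.symm, fun w => by rw [hoc, or_comm]⟩
  have hk := (hoc k).2 (by simp)
  have hTy : NewlySaturated G (insert a (insert b (insert c A))) c y₂ := by
    refine .of_mem (by simp [hA]) (fun w hw hwA => ?_) hd.1 hdB
    have := ho2 w
    grind
  have hc0 : c ∉ A₀ := fun e => hc.2 ((hA c).2 (Or.inl e))
  have hcy2 : c ≠ y₂ := by
    rintro rfl
    exact hc.2 (by simp [hA])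
  have key : ∀ u, u ≠ c → u ≠ y₂ → NewlySaturated G (insert a (insert b (insert c A))) c u →
      False := by
    intro u huc huy hu
    refine h.contra_two {y₂, u} hS (by simp) hgk hadj hdB hk.1 hk.2 ?_ ?_ ?_
    · simp [hcy2, huc.symm]
    · simp [hTy, hu]
    · rw [Finset.card_pair huy.symm]; norm_num
  have hS4 : St (insert d (insert k (insert a (insert b (insert c A))))) 1 :=
    h.expand_two {y₂} hS (by simp) hgk hoc (by simpa using hcy2) (by simpa using hTy) (by simp)
  have hk0 : ∀ v ∈ A₀, ¬ G.Adj k v :=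
    h.not_adj_two ∅ hS (by simp) hgk.symm hk.1 hk.2 hadj hdB (by simp) (by simp) (by simp) hc0
      (by simp)
  have hyA : y₂ ∈ A := by simp [hA]
  have ha := (ho1 a).2 (by simp)
  have hb := (ho1 b).2 (by simp)
  have nk : ∀ u, u = a ∨ u = b → G.Adj u d → G.Adj u k → False := by
    intro u hu hud huk
    refine key u (by grind) (by grind) (.of_mem (by grind) (fun w hw hwA => ?_) hud hdB)
    by_contra hcw
    refine h.false_of_out hS (b := u) (by grind) (by norm_num) hud hdB huk hk.2 hw hwA hgk ?_ ?_
    · rintro rfl; exact hcw hadj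
    · rintro rfl; exact hcw hk.1
  have nka : ¬ G.Adj a k := nk a (by simp) hda.symm
  have nkb : ¬ G.Adj b k := nk b (by simp) hdb.symm
  have nkd : ¬ G.Adj d k := by
    intro hdk
    refine key d hcd.symm (by grind) (.of_not_mem hdB hadj (fun w hw hwA => ?_))
    by_contra hcw
    refine h.false_of_out hS' (b := d) (x := c) (y := k) (z := w) (by grind) (by norm_num)
      hadj.symm (by grind) hdk (by grind) hw (by
        have := hw.ne
        grind) (by grind) (by grind) ?_
    rintro rfl
    exact hcw hk.1
  refine h.false_of_covered hS4 (z := k) (p := c) (q := c) (by simp) (by norm_num) ?_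
  intro w hw hwA
  have := hk0 w
  have := hw.ne
  have := G.adj_comm k w
  have := hx k
  have := ho1 k
  have := ho2 k
  have := hA w
  grind

theorem duo_cross (h : ThinGrowth G A₀ St) {A : Finset V} {x y₁ y₂ a b c d : V}
    (hSt : St A 3) (hA : ∀ v, v ∈ A ↔ v ∈ A₀ ∨ v = x ∨ v = y₁ ∨ v = y₂)
    (hx : ∀ w, G.Adj x w → w ∈ A) (hy1 : y₁ ∉ A₀) (hy2 : y₂ ∉ A₀) (hy : y₁ ≠ y₂)
    (hab : a ≠ b) (hac : a ≠ c) (hbc : b ≠ c) (had : a ≠ d) (hbd : b ≠ d) (hcd : c ≠ d)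
    (ho1 : ∀ w, (G.Adj y₁ w ∧ w ∉ A) ↔ w = a ∨ w = b ∨ w = c)
    (ho2 : ∀ w, (G.Adj y₂ w ∧ w ∉ A) ↔ w = a ∨ w = b ∨ w = d) :
    ∃ g k, g ≠ k ∧ g ≠ d ∧ k ≠ d ∧ G.Adj g k ∧
      (∀ w, (G.Adj c w ∧ w ∉ insert a (insert b (insert c A))) ↔ w = g ∨ w = k) ∧
      (∀ w, (G.Adj a w ∧ w ∉ insert a (insert b (insert c A))) ↔ w = d ∨ w = g) ∧
      (∀ w, (G.Adj b w ∧ w ∉ insert a (insert b (insert c A))) ↔ w = d ∨ w = k) ∧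
      St (insert g (insert k (insert a (insert b (insert c A))))) 2 ∧
      ∀ v ∈ A₀, ¬ G.Adj g v := by
  have hncd : ¬ G.Adj c d :=
    h.duo_adj hSt hA hx hy1 hy2 hy hab hac hbc had hbd hcd ho1 ho2
  have hA2 : ∀ v, v ∈ A ↔ v ∈ A₀ ∨ v = x ∨ v = y₂ ∨ v = y₁ := by
    intro v; rw [hA]; tauto
  obtain ⟨hS, h0⟩ := h.duo_state hSt (by simp [hA]) hy1 hab hac hbc ho1
  have hc := (ho1 c).2 (by simp)
  have hd := (ho2 d).2 (by simp)
  have hcy : ¬ G.Adj y₂ c := fun e => by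
    have := (ho2 c).1 ⟨e, hc.2⟩
    grind
  have hdy : ¬ G.Adj y₁ d := fun e => by
    have := (ho1 d).1 ⟨e, hd.2⟩
    grind
  have hc0 : c ∉ A₀ := fun e => hc.2 ((hA c).2 (Or.inl e))
  obtain ⟨hca, hcb, g, k, hgk, hoc⟩ := h.duo_out hSt hA hx hy1 hab hac hbc ho1 hcy
  obtain ⟨hda, hdb, -⟩ := h.duo_out hSt hA2 hx hy2 hab had hbd ho2 hdy
  have hdB : d ∉ insert a (insert b (insert c A)) := by
    have := hd.2
    grind
  have hg := (hoc g).2 (by simp)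
  have hk := (hoc k).2 (by simp)
  have hgd : g ≠ d := by rintro rfl; exact hncd hg.1
  have hkd : k ≠ d := by rintro rfl; exact hncd hk.1
  have hS4 : St (insert g (insert k (insert a (insert b (insert c A))))) 2 :=
    h.expand_two ∅ hS (by simp) hgk hoc (by simp) (by simp) (by simp)
  have type0 : ∀ u, u = g ∨ u = k → ∀ v ∈ A₀, ¬ G.Adj u v := by
    rintro u (rfl | rfl)
    · exact h.not_adj_two ∅ hS (by simp) hgk hg.1 hg.2 hk.1 hk.2 (by simp) (by simp) (by simp) hc0
        (by simp)
    · exact h.not_adj_two ∅ hS (by simp) hgk.symm hk.1 hk.2 hg.1 hg.2 (by simp) (by simp) (by simp)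
        hc0 (by simp)
  have key : ∀ u u', u = g ∧ u' = k ∨ u = k ∧ u' = g → ∀ p q,
      (∀ w, G.Adj u w → w = c ∨ w = a ∨ w = b ∨ w = u' → w = p ∨ w = q) → False := by
    intro u u' huu p q hpq
    refine h.false_of_covered hS4 (z := u) (p := p) (q := q) (by grind) le_rfl ?_
    intro w hw hwA
    have := type0 u (by grind) w
    have := hw.ne
    have := G.adj_comm u w
    have := hx u
    have := ho1 u
    have := ho2 u
    have := hA w
    have := hpq w hw
    grind
  have notboth : ∀ u, u = a ∨ u = b → G.Adj g u → G.Adj k u → False := by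
    intro u hu hug huk
    refine h.false_of_out hS (b := u) (x := d) (y := g) (z := k) (by grind) (by norm_num) ?_ hdB
      hug.symm hg.2 huk.symm hk.2 hgd.symm hkd.symm hgk
    rcases hu with rfl | rfl
    · exact hda.symm
    · exact hdb.symm
  have kg1 := key g k (by simp) c k
  have kg2 := key g k (by simp) c a
  have kg3 := key g k (by simp) c b
  have kk1 := key k g (by simp) c g
  have kk2 := key k g (by simp) c a
  have kk3 := key k g (by simp) c b
  have na := notboth a (by simp)
  have nb := notboth b (by simp)
  have hgk' : G.Adj g k := by
    have := G.adj_comm g k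
    grind
  have houts : ∀ u e, u = a ∨ u = b → e = g ∨ e = k → G.Adj u e →
      ∀ w, (G.Adj u w ∧ w ∉ insert a (insert b (insert c A))) ↔ w = d ∨ w = e := by
    intro u e hu he hue w
    have hud : G.Adj u d := by
      rcases hu with rfl | rfl
      · exact hda.symm
      · exact hdb.symm
    constructor
    · rintro ⟨hw, hwA⟩
      by_contra hcw
      exact h.false_of_out hS (b := u) (x := d) (y := e) (z := w) (by grind) (by norm_num) hud hdB
        hue (by grind) hw hwA (by grind) (by grind) (by grind)
    · rintro (rfl | rfl)
      · exact ⟨hud, hdB⟩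
      · exact ⟨hue, by grind⟩
  by_cases hga : G.Adj g a
  · have hkb : G.Adj k b := by grind
    exact ⟨g, k, hgk, hgd, hkd, hgk', hoc, houts a g (by simp) (by simp) hga.symm,
      houts b k (by simp) (by simp) hkb.symm, hS4, type0 g (by simp)⟩
  · have hgb : G.Adj g b := by grind
    have hka : G.Adj k a := by grind
    exact ⟨k, g, hgk.symm, hkd, hgd, hgk'.symm, fun w => by rw [hoc, or_comm],
      houts a k (by simp) (by simp) hka.symm,
      houts b g (by simp) (by simp) hgb.symm, by rwa [Finset.insert_comm], type0 k (by simp)⟩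

theorem duo_false_of_two (h : ThinGrowth G A₀ St) {A : Finset V} {x y₁ y₂ a b c d : V}
    (hSt : St A 3) (hA : ∀ v, v ∈ A ↔ v ∈ A₀ ∨ v = x ∨ v = y₁ ∨ v = y₂)
    (hx : ∀ w, G.Adj x w → w ∈ A) (hy1 : y₁ ∉ A₀) (hy2 : y₂ ∉ A₀) (hy : y₁ ≠ y₂)
    (hab : a ≠ b) (hac : a ≠ c) (hbc : b ≠ c) (had : a ≠ d) (hbd : b ≠ d) (hcd : c ≠ d)
    (ho1 : ∀ w, (G.Adj y₁ w ∧ w ∉ A) ↔ w = a ∨ w = b ∨ w = c)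
    (ho2 : ∀ w, (G.Adj y₂ w ∧ w ∉ A) ↔ w = a ∨ w = b ∨ w = d) : False := by
  have hA2 : ∀ v, v ∈ A ↔ v ∈ A₀ ∨ v = x ∨ v = y₂ ∨ v = y₁ := by
    intro v; rw [hA]; tauto
  obtain ⟨g, k, hgk, hgd, hkd, egk, oc, oa, ob, hS, hg0⟩ :=
    h.duo_cross hSt hA hx hy1 hy2 hy hab hac hbc had hbd hcd ho1 ho2
  obtain ⟨g', k', -, hgc', hkc', -, od, oa', -, -, -⟩ :=
    h.duo_cross hSt hA2 hx hy2 hy1 hy.symm hab had hbd hac hbc hcd.symm ho2 ho1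
  have hg := (oc g).2 (by simp)
  have hdg : G.Adj d g := by
    have h1 := (oa' g').2 (by simp)
    have h2 := (oa g').1 ⟨h1.1, by grind⟩
    have h3 : g' ≠ d := by grind
    have h4 : g' = g := by tauto
    subst h4
    exact ((od g').2 (by simp)).1
  have hd := (oa d).2 (by simp)
  have hdB : d ∉ insert g (insert k (insert a (insert b (insert c A)))) := by grind
  obtain ⟨u, v, huv, hog⟩ := h.exists_outs hS (z := g) (p := c) (q := a) (r := k) (by simp) le_rfl
    (by
      intro w hw hwA
      have := hg0 w
      have := hw.ne
      have := G.adj_comm g w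
      have := hx g
      have := ho1 g
      have := ho2 g
      have := ob g
      have := hA w
      grind)
  obtain ⟨e, hed, heg, heB⟩ : ∃ e, d ≠ e ∧ G.Adj g e ∧
      e ∉ insert g (insert k (insert a (insert b (insert c A)))) := by
    by_cases hdu : d = u
    · exact ⟨v, hdu ▸ huv, (hog v).2 (by simp)⟩
    · exact ⟨u, hdu, (hog u).2 (by simp)⟩
  have ya : y₂ ≠ a ∧ y₂ ≠ b ∧ y₂ ≠ g := by
    have := hA y₂
    have := (ho1 a).2 (by simp)
    have := (ho1 b).2 (by simp)
    grind
  refine h.contra_two {a, b, y₂} hS (by simp) hed hdg.symm hdB heg heB ?_ ?_ ?_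
  · have := hg.2
    have := ya.2.2
    grind
  · simp only [Finset.mem_insert, Finset.mem_singleton, forall_eq_or_imp, forall_eq]
    refine ⟨.of_mem (by simp) (fun w hw hwA => ?_) hd.1 hdB,
      .of_mem (by simp) (fun w hw hwA => ?_) ((ob d).2 (by simp)).1 hdB,
      .of_mem (by simp [hA]) (fun w hw hwA => ?_) ((ho2 d).2 (by simp)).1 hdB⟩
    · have := oa w
      have := hdg.symm
      grind
    · have := ob w
      have := hdg.symm
      grind
    · have := ho2 w
      have := hdg.symm
      grind
  · rw [Finset.card_eq_three.2 ⟨a, b, y₂, hab, ya.1.symm, ya.2.1.symm, rfl⟩]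
    norm_num

end ThinGrowth

/-- A state of loss `1` in which all unsaturated vertices outside `A₀` lie in `F`. -/
structure Frontier (G : SimpleGraph V) [DecidableRel G.Adj] (A₀ : Finset V)
    (St : Finset V → ℤ → Prop) (A F : Finset V) : Prop where
  st : St A 1
  mem : ∀ {v}, v ∈ F → v ∈ A
  notMem : ∀ {v}, v ∈ F → v ∉ A₀
  cover : ∀ v w, v ∈ A → v ∉ A₀ → v ∉ F → G.Adj v w → w ∈ A

theorem exists_pair_of_adj {A : Finset V} {p z : V} (hc : (G.neighborFinset p \ A).card = 2)
    (hz : G.Adj p z) (hzA : z ∉ A) :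
    ∃ z', z ≠ z' ∧ ∀ w, (G.Adj p w ∧ w ∉ A) ↔ w = z ∨ w = z' := by
  obtain ⟨x, y, hxy, ho⟩ := exists_pair_of_card_out hc
  rcases (ho z).1 ⟨hz, hzA⟩ with rfl | rfl
  · exact ⟨y, hxy, ho⟩
  · exact ⟨x, hxy.symm, fun w => by rw [ho, or_comm]⟩

namespace ThinGrowth

theorem frontier_not_adj (h : ThinGrowth G A₀ St) {A F : Finset V} {p z z' : V}
    (hQ : Frontier G A₀ St A F) (hp : p ∈ F) (hz : z ≠ z')
    (op : ∀ w, (G.Adj p w ∧ w ∉ A) ↔ w = z ∨ w = z') : ∀ c ∈ A₀, ¬ G.Adj z c := by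
  have h1 := (op z).2 (by simp)
  have h2 := (op z').2 (by simp)
  exact h.not_adj_two ∅ hQ.st (hQ.mem hp) hz h1.1 h1.2 h2.1 h2.2 (by simp) (by simp) (by simp)
    (hQ.notMem hp) (by simp)

theorem frontier_covered (h : ThinGrowth G A₀ St) {A F : Finset V} {p z z' : V}
    (hQ : Frontier G A₀ St A F) (hp : p ∈ F) (hz : z ≠ z')
    (op : ∀ w, (G.Adj p w ∧ w ∉ A) ↔ w = z ∨ w = z') :
    ∀ w, G.Adj z w → w ∈ insert z (insert z' A) → w ∈ F ∨ w = z' := by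
  intro w hw hwA
  have := h.frontier_not_adj hQ hp hz op w
  have := hw.ne
  have := hw.symm
  have := (op z).2 (by simp)
  have := hQ.cover w z
  grind

/-- A vertex reached from the frontier has at least three neighbours in the frontier or reached
together with it. -/
theorem frontier_false (h : ThinGrowth G A₀ St) {A F : Finset V} {p z z' u v : V}
    (hQ : Frontier G A₀ St A F) (hp : p ∈ F) (hz : z ≠ z')
    (op : ∀ w, (G.Adj p w ∧ w ∉ A) ↔ w = z ∨ w = z')
    (hB : ∀ w, G.Adj z w → w ∈ F ∨ w = z' → w = u ∨ w = v) : False := by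
  have hS : St (insert z (insert z' A)) 2 :=
    h.expand_two ∅ hQ.st (hQ.mem hp) hz op (by simp) (by simp) (by simp)
  exact h.false_of_covered hS (z := z) (by simp) le_rfl
    fun w hw hwA => hB w hw (h.frontier_covered hQ hp hz op w hw hwA)

theorem frontier_double_touch (h : ThinGrowth G A₀ St) {A F : Finset V} {p q r s z z' : V}
    (hQ : Frontier G A₀ St A F) (hF : ∀ v, v ∈ F ↔ v = p ∨ v = q ∨ v = r ∨ v = s)
    (hpq : p ≠ q) (hpr : p ≠ r) (hqr : q ≠ r) (hrs : r ≠ s)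
    (hc : ∀ v ∈ F, (G.neighborFinset v \ A).card = 2) (hz : z ≠ z')
    (op : ∀ w, (G.Adj p w ∧ w ∉ A) ↔ w = z ∨ w = z')
    (oq : ∀ w, (G.Adj q w ∧ w ∉ A) ↔ w = z ∨ w = z') : ¬ G.Adj r z := by
  intro hrz
  have hpF : p ∈ F := by simp [hF]
  have hqF : q ∈ F := by simp [hF]
  have hrF : r ∈ F := by simp [hF]
  have hsF : s ∈ F := by simp [hF]
  have pz := (op z).2 (by simp)
  have pz' := (op z').2 (by simp)
  have qz := (oq z).2 (by simp)
  have qz' := (oq z').2 (by simp)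
  have satq : NewlySaturated G A p q :=
    .of_mem (hQ.mem hqF) (fun w hw hwA => ((op w).2 ((oq w).1 ⟨hw, hwA⟩)).1) qz.1 qz.2
  obtain ⟨y, hzy, or⟩ := exists_pair_of_adj (hc r hrF) hrz pz.2
  have ry := (or y).2 (by simp)
  have or' : ∀ w, (G.Adj r w ∧ w ∉ A) ↔ w = y ∨ w = z := fun w => by rw [or, or_comm]
  have hyz' : y ≠ z' := by
    rintro rfl
    refine h.contra_two {q, r} hQ.st (hQ.mem hpF) hz pz.1 pz.2 pz'.1 pz'.2 (by grind) ?_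
      (by rw [Finset.card_pair hqr]; norm_num)
    simp only [Finset.mem_insert, Finset.mem_singleton, forall_eq_or_imp, forall_eq]
    exact ⟨satq, .of_mem (hQ.mem hrF) (fun w hw hwA => ((op w).2 ((or w).1 ⟨hw, hwA⟩)).1)
      hrz pz.2⟩
  have npy : ¬ G.Adj p y := fun e => by
    have := (op y).1 ⟨e, ry.2⟩
    grind
  have nqy : ¬ G.Adj q y := fun e => by
    have := (oq y).1 ⟨e, ry.2⟩
    grind
  have hsy : G.Adj s y := by
    by_contra hn
    refine h.frontier_false hQ hrF hzy.symm or' (u := r) (v := z) ?_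
    intro w hw hwF
    have := hw.symm
    grind
  have hyz : G.Adj y z := by
    by_contra hn
    refine h.frontier_false hQ hrF hzy.symm or' (u := r) (v := s) ?_
    intro w hw hwF
    have := hw.symm
    grind
  obtain ⟨x, hyx, os⟩ := exists_pair_of_adj (hc s hsF) hsy ry.2
  have sx := (os x).2 (by simp)
  have os' : ∀ w, (G.Adj s w ∧ w ∉ A) ↔ w = x ∨ w = y := fun w => by rw [os, or_comm]
  have hx : x = z ∨ x = z' := by
    by_contra hn
    refine h.frontier_false hQ hsF hyx.symm os' (u := s) (v := y) ?_
    intro w hw hwF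
    have := hw.symm
    have := op x
    have := oq x
    have := or x
    grind
  have hN : ∀ w, G.Adj z w → w ∉ A → w = z' ∨ w = y := by
    intro w hw hwA
    by_contra hn
    have hS : St (insert z (insert z' A)) 1 :=
      h.expand_two {q} hQ.st (hQ.mem hpF) hz op (by simpa using hpq) (by simpa using satq) (by simp)
    have := hw.ne
    have := hQ.mem hrF
    have := hQ.mem hsF
    refine h.contra_two {r, s} hS (b := z) (x := y) (y := w) (by simp) (by grind) hyz.symm
      (by grind) hw (by grind) (by grind) ?_ (by rw [Finset.card_pair hrs]; norm_num)
    simp only [Finset.mem_insert, Finset.mem_singleton, forall_eq_or_imp, forall_eq]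
    refine ⟨.of_mem (by grind) (fun w hw hwA => ?_) ry.1 (by grind),
      .of_mem (by grind) (fun w hw hwA => ?_) hsy (by grind)⟩
    · have := or w
      have := hyz.symm
      grind
    · have := os w
      have := hyz.symm
      grind
  have hcov : ∀ w, G.Adj y w → w ∈ insert z (insert y A) → w = r ∨ w = s ∨ w = z := by
    intro w hw hwA
    have := h.frontier_covered hQ hrF hzy.symm or' w hw (by rwa [Finset.insert_comm])
    have := hw.symm
    grind
  have hzA := pz.2
  have hyA := ry.2
  have hpA := hQ.mem hpF
  have hqA := hQ.mem hqF
  have hrA := hQ.mem hrF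
  have hsA := hQ.mem hsF
  have hy0 : y ∉ A₀ := fun e => hyA (h.subset hQ.st e)
  have pzB : z' ∉ insert z (insert y A) := by
    have := pz'.2
    grind
  by_cases hyz2 : G.Adj y z'
  · have satp : NewlySaturated G (insert z (insert y A)) y p := by
      refine .of_mem (by grind) (fun w hw hwA => ?_) pz'.1 pzB
      have := op w
      grind
    have satq : NewlySaturated G (insert z (insert y A)) y q := by
      refine .of_mem (by grind) (fun w hw hwA => ?_) qz'.1 pzB
      have := oq w
      grind
    have hex : ∀ t ≤ (2 : ℤ), St (insert z (insert y A)) t →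
        ∃ e, z' ≠ e ∧ G.Adj y e ∧ e ∉ insert z (insert y A) := by
      intro t ht hS
      obtain ⟨a, b, hab, ho⟩ := h.exists_outs hS (by simp) ht hcov
      by_cases hza : z' = a
      · exact ⟨b, hza ▸ hab, (ho b).2 (by simp)⟩
      · exact ⟨a, hza, (ho a).2 (by simp)⟩
    by_cases hzz : G.Adj z z'
    · have hS : St (insert z (insert y A)) 2 :=
        h.expand_two ∅ hQ.st hrA hzy or (by simp) (by simp) (by simp)
      obtain ⟨e, hze, hye, heB⟩ := hex 2 le_rfl hS
      refine h.contra_two {p, q, z} hS (by simp) hze hyz2 pzB hye heB (by grind) ?_ ?_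
      · simp only [Finset.mem_insert, Finset.mem_singleton, forall_eq_or_imp, forall_eq]
        refine ⟨satp, satq, .of_mem (by simp) (fun w hw hwA => ?_) hzz pzB⟩
        have := hN w hw
        grind
      · rw [Finset.card_eq_three.2 ⟨p, q, z, hpq, by grind, by grind, rfl⟩]
        norm_num
    · have hS : St (insert z (insert y A)) 1 := by
        refine h.expand_two {z} hQ.st hrA hzy or (by grind) ?_ (by simp)
        simp only [Finset.mem_singleton, forall_eq]
        refine .of_not_mem hzA hrz (fun w hw hwA => ?_)
        have := hN w hw hwA
        grind
      obtain ⟨e, hze, hye, heB⟩ := hex 1 (by norm_num) hS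
      refine h.contra_two {p, q} hS (by simp) hze hyz2 pzB hye heB (by grind) ?_
        (by rw [Finset.card_pair hpq]; norm_num)
      simp only [Finset.mem_insert, Finset.mem_singleton, forall_eq_or_imp, forall_eq]
      exact ⟨satp, satq⟩
  · have hxz : x = z := by
      by_contra hn
      refine h.frontier_false hQ hsF hyx os (u := r) (v := s) ?_
      intro w hw hwF
      have := hw.symm
      grind
    subst hxz
    have hS : St (insert x (insert y A)) 1 := by
      refine h.expand_two {s} hQ.st hrA hzy or (by simpa using hrs) ?_ (by simp)
      simp only [Finset.mem_singleton, forall_eq]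
      exact .of_mem hsA (fun w hw hwA => ((or w).2 (((os' w).1 ⟨hw, hwA⟩))).1) hsy hyA
    obtain ⟨a, b, hab, ho⟩ := h.exists_outs hS (by simp) (by norm_num) hcov
    have ya := (ho a).2 (by simp)
    have yb := (ho b).2 (by simp)
    have hS2 : St (insert a (insert b (insert x (insert y A)))) 2 :=
      h.expand_two ∅ hS (by simp) hab ho (by simp) (by simp) (by simp)
    refine h.false_of_covered hS2 (z := a) (p := y) (q := b) (by simp) le_rfl ?_
    intro w hw hwA
    have := h.not_adj_two ∅ hS (by simp) hab ya.1 ya.2 yb.1 yb.2 (by simp) (by simp) (by simp) hy0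
      (by simp) w
    have := hw.symm
    have := hw.ne
    have := hN a
    have := op a
    have := oq a
    have := or a
    have := os a
    have := hF w
    have := hQ.cover w a
    grind

theorem frontier_double (h : ThinGrowth G A₀ St) {A F : Finset V} {p q r s z z' : V}
    (hQ : Frontier G A₀ St A F) (hF : ∀ v, v ∈ F ↔ v = p ∨ v = q ∨ v = r ∨ v = s)
    (hpq : p ≠ q) (hpr : p ≠ r) (hps : p ≠ s) (hqr : q ≠ r) (hqs : q ≠ s) (hrs : r ≠ s)
    (hc : ∀ v ∈ F, (G.neighborFinset v \ A).card = 2) (hz : z ≠ z')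
    (op : ∀ w, (G.Adj p w ∧ w ∉ A) ↔ w = z ∨ w = z')
    (oq : ∀ w, (G.Adj q w ∧ w ∉ A) ↔ w = z ∨ w = z') :
    ∃ A' F', A ⊂ A' ∧ Frontier G A₀ St A' F' ∧ F'.card = 4 ∧
      ∀ v ∈ F', (G.neighborFinset v \ A').card = 2 := by
  have hF' : ∀ v, v ∈ F ↔ v = p ∨ v = q ∨ v = s ∨ v = r := fun v => by rw [hF]; tauto
  have op' : ∀ w, (G.Adj p w ∧ w ∉ A) ↔ w = z' ∨ w = z := fun w => by rw [op, or_comm]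
  have oq' : ∀ w, (G.Adj q w ∧ w ∉ A) ↔ w = z' ∨ w = z := fun w => by rw [oq, or_comm]
  have rz := h.frontier_double_touch hQ hF hpq hpr hqr hrs hc hz op oq
  have rz' := h.frontier_double_touch hQ hF hpq hpr hqr hrs hc hz.symm op' oq'
  have sz := h.frontier_double_touch hQ hF' hpq hps hqs hrs.symm hc hz op oq
  have sz' := h.frontier_double_touch hQ hF' hpq hps hqs hrs.symm hc hz.symm op' oq'
  have hpF : p ∈ F := by simp [hF]
  have hqF : q ∈ F := by simp [hF]
  have hrA : r ∈ A := hQ.mem (by simp [hF])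
  have hsA : s ∈ A := hQ.mem (by simp [hF])
  have hr0 : r ∉ A₀ := hQ.notMem (by simp [hF])
  have hs0 : s ∉ A₀ := hQ.notMem (by simp [hF])
  have pz := (op z).2 (by simp)
  have pz' := (op z').2 (by simp)
  have qz := (oq z).2 (by simp)
  have hzA := pz.2
  have hzA' := pz'.2
  have hsub : ∀ v, v ∈ A₀ → v ∈ A := fun v hv => h.subset hQ.st hv
  have hS : St (insert z (insert z' A)) 1 := by
    refine h.expand_two {q} hQ.st (hQ.mem hpF) hz op (by simpa using hpq) ?_ (by simp)
    simp only [Finset.mem_singleton, forall_eq]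
    exact .of_mem (hQ.mem hqF) (fun w hw hwA => ((op w).2 ((oq w).1 ⟨hw, hwA⟩)).1) qz.1 qz.2
  have houts : ∀ u u', u = z ∧ u' = z' ∨ u = z' ∧ u' = z →
      (G.neighborFinset u \ insert z (insert z' A)).card = 2 := by
    intro u u' huu
    refine le_antisymm (h.card_out_le hS (by grind) (by norm_num))
      (h.two_le_out (p := p) (q := q) (r := u') ?_)
    intro w hw hwA
    have : w ∈ F ∨ w = u' := by
      rcases huu with ⟨rfl, rfl⟩ | ⟨rfl, rfl⟩
      · exact h.frontier_covered hQ hpF hz op w hw hwA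
      · exact h.frontier_covered hQ hpF hz.symm op' w hw (by rwa [Finset.insert_comm])
    have := hw.symm
    grind
  have hkeep : ∀ u, u = r ∨ u = s → (G.neighborFinset u \ insert z (insert z' A)).card = 2 := by
    intro u hu
    rw [← hc u (by grind)]
    congr 1
    ext w
    simp only [Finset.mem_sdiff, mem_neighborFinset, Finset.mem_insert]
    grind
  refine ⟨insert z (insert z' A), {r, s, z, z'}, ?_, ⟨hS, ?_, ?_, ?_⟩, ?_, ?_⟩
  · rw [Finset.ssubset_iff]
    exact ⟨z, hzA, by grind⟩
  · grind
  · intro v hv hv0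
    have := hsub v hv0
    grind
  · intro v w hv hv0 hvF hw
    have := hQ.cover v w
    have := op w
    have := oq w
    grind
  · rw [Finset.card_insert_of_notMem (by grind), Finset.card_insert_of_notMem (by grind),
      Finset.card_pair hz]
  · intro v hv
    simp only [Finset.mem_insert, Finset.mem_singleton] at hv
    rcases hv with rfl | rfl | rfl | rfl
    · exact hkeep _ (Or.inl rfl)
    · exact hkeep _ (Or.inr rfl)
    · exact houts _ _ (Or.inl ⟨rfl, rfl⟩)
    · exact houts _ _ (Or.inr ⟨rfl, rfl⟩)

/-- If the out-pairs of the frontier form a 4-cycle, then `z₁` has exactly one further neighbour,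
which is also adjacent to the two neighbours of `z₁` on the cycle. -/
theorem frontier_cycle_out (h : ThinGrowth G A₀ St) {A F : Finset V} {p q r s z₁ z₂ z₃ z₄ : V}
    (hQ : Frontier G A₀ St A F) (hF : ∀ v, v ∈ F ↔ v = p ∨ v = q ∨ v = r ∨ v = s)
    (hqr : q ≠ r) (hqs : q ≠ s) (hrs : r ≠ s)
    (h12 : z₁ ≠ z₂) (h13 : z₁ ≠ z₃) (h14 : z₁ ≠ z₄) (h23 : z₂ ≠ z₃) (h24 : z₂ ≠ z₄) (h34 : z₃ ≠ z₄)
    (op : ∀ w, (G.Adj p w ∧ w ∉ A) ↔ w = z₁ ∨ w = z₂)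
    (oq : ∀ w, (G.Adj q w ∧ w ∉ A) ↔ w = z₂ ∨ w = z₃)
    (or : ∀ w, (G.Adj r w ∧ w ∉ A) ↔ w = z₃ ∨ w = z₄)
    (os : ∀ w, (G.Adj s w ∧ w ∉ A) ↔ w = z₄ ∨ w = z₁) :
    ∃ x, x ≠ z₁ ∧ x ≠ z₂ ∧ x ≠ z₃ ∧ x ≠ z₄ ∧ x ∉ A ∧ G.Adj x z₂ ∧ G.Adj x z₄ ∧
      (∀ w, (G.Adj z₁ w ∧ w ∉ A) ↔ w = z₂ ∨ w = z₄ ∨ w = x) ∧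
      St (insert z₄ (insert x (insert z₁ (insert z₂ A)))) 2 ∧
      ∀ w, G.Adj x w → w ∈ insert z₄ (insert x (insert z₁ (insert z₂ A))) →
        w = z₁ ∨ w = z₂ ∨ w = z₄ := by
  have hpF : p ∈ F := by simp [hF]
  have hsF : s ∈ F := by simp [hF]
  have hqA : q ∈ A := hQ.mem (by simp [hF])
  have hrA : r ∈ A := hQ.mem (by simp [hF])
  have hsA : s ∈ A := hQ.mem hsF
  have p1 := (op z₁).2 (by simp)
  have p2 := (op z₂).2 (by simp)
  have q3 := (oq z₃).2 (by simp)
  have s4 := (os z₄).2 (by simp)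
  have z1A := p1.2
  have z2A := p2.2
  have z3A := q3.2
  have z4A := s4.2
  have os' : ∀ w, (G.Adj s w ∧ w ∉ A) ↔ w = z₁ ∨ w = z₄ := fun w => by rw [os, or_comm]
  have nq : ¬ G.Adj q z₁ := fun e => by
    have := (oq z₁).1 ⟨e, z1A⟩
    grind
  have nr : ¬ G.Adj r z₁ := fun e => by
    have := (or z₁).1 ⟨e, z1A⟩
    grind
  have a12 : G.Adj z₁ z₂ := by
    by_contra hn
    refine h.frontier_false hQ hpF h12 op (u := p) (v := s) ?_
    intro w hw hwF
    have := hw.symm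
    grind
  have a14 : G.Adj z₁ z₄ := by
    by_contra hn
    refine h.frontier_false hQ hsF h14 os' (u := p) (v := s) ?_
    intro w hw hwF
    have := hw.symm
    grind
  have hS : St (insert z₁ (insert z₂ A)) 2 :=
    h.expand_two ∅ hQ.st (hQ.mem hpF) h12 op (by simp) (by simp) (by simp)
  have hcov : ∀ w, G.Adj z₁ w → w ∈ insert z₁ (insert z₂ A) → w = p ∨ w = s ∨ w = z₂ := by
    intro w hw hwA
    have := h.frontier_covered hQ hpF h12 op w hw hwA
    have := hw.symm
    grind
  have hc2 : (G.neighborFinset z₁ \ insert z₁ (insert z₂ A)).card = 2 :=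
    le_antisymm (h.card_out_le hS (by simp) le_rfl) (h.two_le_out hcov)
  have z4B : z₄ ∉ insert z₁ (insert z₂ A) := by grind
  obtain ⟨x, h4x, ho⟩ := exists_pair_of_adj hc2 a14 z4B
  have zx := (ho x).2 (by simp)
  have xB := zx.2
  have sats : NewlySaturated G (insert z₁ (insert z₂ A)) z₁ s := by
    refine .of_mem (by grind) (fun w hw hwA => ?_) s4.1 z4B
    have := os w
    grind
  have hx3 : x ≠ z₃ := by
    rintro rfl
    refine h.contra_two {s, q, r} hS (by simp) h4x a14 z4B zx.1 zx.2 (by grind) ?_ ?_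
    · simp only [Finset.mem_insert, Finset.mem_singleton, forall_eq_or_imp, forall_eq]
      refine ⟨sats, .of_mem (by grind) (fun w hw hwA => ?_) q3.1 xB,
        .of_mem (by grind) (fun w hw hwA => ?_) ((or x).2 (by simp)).1 xB⟩
      · have := oq w
        grind
      · have := or w
        grind
    · rw [Finset.card_eq_three.2 ⟨s, q, r, hqs.symm, hrs.symm, hqr, rfl⟩]
      norm_num
  have hz0 : z₁ ∉ A₀ := fun e => z1A (h.subset hQ.st e)
  have hsz : z₁ ∉ ({s} : Finset V) := by grind
  have hS2 : St (insert z₄ (insert x (insert z₁ (insert z₂ A)))) 2 :=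
    h.expand_two {s} hS (by simp) h4x ho hsz (by simpa using sats) (by simp)
  have hx0 := h.not_adj_two {s} hS (by simp) h4x.symm zx.1 zx.2 a14 z4B hsz (by simpa using sats)
    (by simp) hz0 (by simpa using hQ.notMem hsF)
  have hcx : ∀ w, G.Adj x w → w ∈ insert z₄ (insert x (insert z₁ (insert z₂ A))) →
        w = z₁ ∨ w = z₂ ∨ w = z₄ := by
    intro w hw hwA
    have := hx0 w
    have := hw.symm
    have := hw.ne
    have := op x
    have := oq x
    have := or x
    have := os x
    have := hF w
    have := hQ.cover w x
    grind
  refine ⟨x, by grind, by grind, hx3, h4x.symm, by grind, ?_, ?_, ?_, hS2, hcx⟩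
  · by_contra hn
    refine h.false_of_covered hS2 (z := x) (p := z₁) (q := z₄) (by simp) le_rfl ?_
    intro w hw hwA
    have := hcx w hw hwA
    grind
  · by_contra hn
    refine h.false_of_covered hS2 (z := x) (p := z₁) (q := z₂) (by simp) le_rfl ?_
    intro w hw hwA
    have := hcx w hw hwA
    grind
  · intro w
    have := ho w
    have := G.loopless.irrefl z₁
    grind

theorem frontier_cycle (h : ThinGrowth G A₀ St) {A F : Finset V} {p q r s z₁ z₂ z₃ z₄ : V}
    (hQ : Frontier G A₀ St A F) (hF : ∀ v, v ∈ F ↔ v = p ∨ v = q ∨ v = r ∨ v = s)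
    (hpr : p ≠ r) (hps : p ≠ s) (hqr : q ≠ r) (hqs : q ≠ s) (hrs : r ≠ s)
    (h12 : z₁ ≠ z₂) (h13 : z₁ ≠ z₃) (h14 : z₁ ≠ z₄) (h23 : z₂ ≠ z₃) (h24 : z₂ ≠ z₄) (h34 : z₃ ≠ z₄)
    (op : ∀ w, (G.Adj p w ∧ w ∉ A) ↔ w = z₁ ∨ w = z₂)
    (oq : ∀ w, (G.Adj q w ∧ w ∉ A) ↔ w = z₂ ∨ w = z₃)
    (or : ∀ w, (G.Adj r w ∧ w ∉ A) ↔ w = z₃ ∨ w = z₄)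
    (os : ∀ w, (G.Adj s w ∧ w ∉ A) ↔ w = z₄ ∨ w = z₁) : False := by
  obtain ⟨x, hx1, hx2, hx3, hx4, hxA, ax2, ax4, o1, hS, hcx⟩ :=
    h.frontier_cycle_out hQ hF hqr hqs hrs h12 h13 h14 h23 h24 h34 op oq or os
  obtain ⟨x', -, -, -, -, -, ax3, -, o2, -, -⟩ :=
    h.frontier_cycle_out hQ (fun v => by rw [hF]; tauto) hrs hpr.symm hps.symm
      h23 h24 h12.symm h34 h13.symm h14.symm oq or os op
  obtain rfl : x = x' := by
    have := (o2 x).1 ⟨ax2.symm, hxA⟩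
    grind
  have q3 := (oq z₃).2 (by simp)
  have z2 := (o2 z₃).2 (by simp)
  have z3A := q3.2
  have hqA : q ∈ A := hQ.mem (by simp [hF])
  have hrA : r ∈ A := hQ.mem (by simp [hF])
  have z2A := ((oq z₂).2 (by simp)).2
  have z3C : z₃ ∉ insert z₄ (insert x (insert z₁ (insert z₂ A))) := by grind
  obtain ⟨e, h3e, ho⟩ := exists_pair_of_adj
    (le_antisymm (h.card_out_le hS (by simp) le_rfl) (h.two_le_out hcx)) ax3 z3C
  have xe := (ho e).2 (by simp)
  refine h.contra_two {q, r, z₂} hS (by simp) h3e ax3 z3C xe.1 xe.2 (by grind) ?_ ?_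
  · simp only [Finset.mem_insert, Finset.mem_singleton, forall_eq_or_imp, forall_eq]
    refine ⟨.of_mem (by grind) (fun w hw hwA => ?_) q3.1 z3C,
      .of_mem (by grind) (fun w hw hwA => ?_) ((or z₃).2 (by simp)).1 z3C,
      .of_mem (by grind) (fun w hw hwA => ?_) z2.1 z3C⟩
    · have := oq w
      grind
    · have := or w
      grind
    · have := o2 w
      grind
  · rw [Finset.card_eq_three.2 ⟨q, r, z₂, hqr, by grind, by grind, rfl⟩]
    norm_num

theorem frontier_touch (h : ThinGrowth G A₀ St) {A F : Finset V} {p z z' : V}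
    (hQ : Frontier G A₀ St A F) (hp : p ∈ F) (hz : z ≠ z')
    (op : ∀ w, (G.Adj p w ∧ w ∉ A) ↔ w = z ∨ w = z') : ∃ q ∈ F, q ≠ p ∧ G.Adj q z := by
  by_contra! hn
  refine h.frontier_false hQ hp hz op (u := p) (v := z') ?_
  intro w hw hwF
  have := hn w
  have := hw.symm
  grind

theorem exists_double (h : ThinGrowth G A₀ St) {A F : Finset V}
    (hQ : Frontier G A₀ St A F) (hF : F.card = 4)
    (hc : ∀ v ∈ F, (G.neighborFinset v \ A).card = 2) :
    ∃ p ∈ F, ∃ q ∈ F, p ≠ q ∧ ∃ z z', z ≠ z' ∧ (∀ w, (G.Adj p w ∧ w ∉ A) ↔ w = z ∨ w = z') ∧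
      ∀ w, (G.Adj q w ∧ w ∉ A) ↔ w = z ∨ w = z' := by
  by_contra! hn
  have hD : ∀ p ∈ F, ∀ q ∈ F, p ≠ q → ∀ z z', z ≠ z' →
      (∀ w, (G.Adj p w ∧ w ∉ A) ↔ w = z ∨ w = z') →
      (∀ w, (G.Adj q w ∧ w ∉ A) ↔ w = z ∨ w = z') → False := by
    intro p hp q hq hpq z z' hz op oq
    obtain ⟨w, hw⟩ := hn p hp q hq hpq z z' hz op
    have := oq w
    tauto
  obtain ⟨p, hp⟩ := Finset.card_pos.1 (by omega : 0 < F.card)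
  obtain ⟨z₁, z₂, h12, op⟩ := exists_pair_of_card_out (hc p hp)
  have op' : ∀ w, (G.Adj p w ∧ w ∉ A) ↔ w = z₂ ∨ w = z₁ := fun w => by rw [op, or_comm]
  have p1 := (op z₁).2 (by simp)
  have p2 := (op z₂).2 (by simp)
  obtain ⟨q, hq, hqp, hq2⟩ := h.frontier_touch hQ hp h12.symm op'
  obtain ⟨s, hs, hsp, hs1⟩ := h.frontier_touch hQ hp h12 op
  obtain ⟨z₃, h23, oq⟩ := exists_pair_of_adj (hc q hq) hq2 p2.2
  obtain ⟨z₄, h14, os⟩ := exists_pair_of_adj (hc s hs) hs1 p1.2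
  have oq' : ∀ w, (G.Adj q w ∧ w ∉ A) ↔ w = z₃ ∨ w = z₂ := fun w => by rw [oq, or_comm]
  have os' : ∀ w, (G.Adj s w ∧ w ∉ A) ↔ w = z₄ ∨ w = z₁ := fun w => by rw [os, or_comm]
  have q3 := (oq z₃).2 (by simp)
  have s4 := (os z₄).2 (by simp)
  have h13 : z₁ ≠ z₃ := by
    rintro rfl
    exact hD p hp q hq hqp.symm _ _ h12 op oq'
  have h24 : z₂ ≠ z₄ := by
    rintro rfl
    exact hD p hp s hs hsp.symm _ _ h12 op os
  have hqs : q ≠ s := by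
    rintro rfl
    have := oq z₁
    have := os z₂
    grind
  obtain ⟨r, hr⟩ := Finset.card_pos.1 (by
    have := Finset.le_card_sdiff {p, q, s} F
    have := Finset.card_le_three (a := p) (b := q) (c := s)
    omega : 0 < (F \ {p, q, s}).card)
  have hrF : r ∈ F := by grind
  have hrp : r ≠ p := by grind
  have hrq : r ≠ q := by grind
  have hrs : r ≠ s := by grind
  have hF' : ∀ v, v ∈ F ↔ v = p ∨ v = q ∨ v = r ∨ v = s := by
    have : ({p, q, r, s} : Finset V) = F := by
      refine Finset.eq_of_subset_of_card_le (by grind) ?_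
      rw [hF, Finset.card_insert_of_notMem (by grind), Finset.card_insert_of_notMem (by grind),
        Finset.card_pair hrs]
    intro v
    rw [← this]
    simp
  by_cases h34 : z₃ = z₄
  · subst h34
    obtain ⟨a, b, hab, or⟩ := exists_pair_of_card_out (hc r hrF)
    have or' : ∀ w, (G.Adj r w ∧ w ∉ A) ↔ w = b ∨ w = a := fun w => by rw [or, or_comm]
    have key : ∀ u u', u ≠ u' → (∀ w, (G.Adj r w ∧ w ∉ A) ↔ w = u ∨ w = u') →
        u = z₁ ∨ u = z₂ ∨ u = z₃ := by
      intro u u' huu ou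
      obtain ⟨v, hv, hvr, hvu⟩ := h.frontier_touch hQ hrF huu ou
      have := (ou u).2 (by simp)
      have := op u
      have := oq u
      have := os u
      grind
    have hor : ∀ u u', u = a ∧ u' = b ∨ u = b ∧ u' = a →
        ∀ w, (G.Adj r w ∧ w ∉ A) ↔ w = u ∨ w = u' := by
      rintro u u' (⟨rfl, rfl⟩ | ⟨rfl, rfl⟩)
      · exact or
      · exact or'
    have d1 := fun h => hD p hp r hrF hrp.symm _ _ h12 op (hor _ _ h)
    have d2 := fun h => hD p hp r hrF hrp.symm _ _ h12.symm op' (hor _ _ h)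
    have d3 := fun h => hD q hq r hrF hrq.symm _ _ h23 oq (hor _ _ h)
    have d4 := fun h => hD q hq r hrF hrq.symm _ _ h23.symm oq' (hor _ _ h)
    have d5 := fun h => hD s hs r hrF hrs.symm _ _ h14 os (hor _ _ h)
    have d6 := fun h => hD s hs r hrF hrs.symm _ _ h14.symm os' (hor _ _ h)
    have ka := key a b hab or
    have kb := key b a hab.symm or'
    grind
  · obtain ⟨v, hv, hvq, hv3⟩ := h.frontier_touch hQ hq h23.symm oq'
    obtain ⟨u, hu, hus, hu4⟩ := h.frontier_touch hQ hs h14.symm os'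
    have hvr : v = r := by
      have := op z₃
      have := os z₃
      grind
    have hur : u = r := by
      have := op z₄
      have := oq z₄
      grind
    subst hvr hur
    obtain ⟨x, h3x, or⟩ := exists_pair_of_adj (hc u hrF) hv3 q3.2
    obtain rfl : x = z₄ := by
      have := (or z₄).1 ⟨hu4, s4.2⟩
      grind
    exact h.frontier_cycle hQ hF' hrp.symm hsp.symm hrq.symm hqs hrs h12 h13 h14 h23 h24 h34
      op oq or os'

theorem not_frontier (h : ThinGrowth G A₀ St) {A F : Finset V}
    (hQ : Frontier G A₀ St A F) (hF : F.card = 4)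
    (hc : ∀ v ∈ F, (G.neighborFinset v \ A).card = 2) : False := by
  obtain ⟨p, hp, q, hq, hpq, z, z', hz, op, oq⟩ := h.exists_double hQ hF hc
  have h2 : ((F.erase p).erase q).card = 2 := by
    rw [Finset.card_erase_of_mem (by simp [hq, hpq.symm]), Finset.card_erase_of_mem hp, hF]
  obtain ⟨r, s, hrs, he⟩ := Finset.card_eq_two.1 h2
  have he' : ∀ v, (v ≠ q ∧ v ≠ p ∧ v ∈ F) ↔ v = r ∨ v = s := by
    intro v
    simpa using Finset.ext_iff.1 he v
  have hr := (he' r).2 (by simp)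
  have hs := (he' s).2 (by simp)
  obtain ⟨A', F', hlt, hQ', hF', hc'⟩ := h.frontier_double hQ (p := p) (q := q) (r := r) (s := s)
    (fun v => by have := he' v; grind) hpq hr.2.1.symm hs.2.1.symm hr.1.symm hs.1.symm hrs hc hz
    op oq
  exact h.not_frontier hQ' hF' hc'
termination_by Fintype.card V - A.card
decreasing_by
  have := Finset.card_lt_card hlt
  have := Finset.card_le_univ A'
  omega

theorem duo_false_of_one (h : ThinGrowth G A₀ St) {A : Finset V} {x y₁ y₂ a b c d e : V}
    (hSt : St A 3) (hA : ∀ v, v ∈ A ↔ v ∈ A₀ ∨ v = x ∨ v = y₁ ∨ v = y₂)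
    (hx : ∀ w, G.Adj x w → w ∈ A) (hy1 : y₁ ∉ A₀) (hy2 : y₂ ∉ A₀)
    (hab : a ≠ b) (hac : a ≠ c) (hbc : b ≠ c) (had : a ≠ d) (hae : a ≠ e) (hde : d ≠ e)
    (hbd : b ≠ d) (hbe : b ≠ e) (hcd : c ≠ d) (hce : c ≠ e)
    (ho1 : ∀ w, (G.Adj y₁ w ∧ w ∉ A) ↔ w = a ∨ w = b ∨ w = c)
    (ho2 : ∀ w, (G.Adj y₂ w ∧ w ∉ A) ↔ w = a ∨ w = d ∨ w = e) : False := by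
  have hA2 : ∀ v, v ∈ A ↔ v ∈ A₀ ∨ v = x ∨ v = y₂ ∨ v = y₁ := by
    intro v; rw [hA]; tauto
  have ho1' : ∀ w, (G.Adj y₁ w ∧ w ∉ A) ↔ w = a ∨ w = c ∨ w = b := by
    intro v; rw [ho1]; tauto
  have ho2' : ∀ w, (G.Adj y₂ w ∧ w ∉ A) ↔ w = a ∨ w = e ∨ w = d := by
    intro v; rw [ho2]; tauto
  obtain ⟨hS, -⟩ := h.duo_state hSt (by simp [hA]) hy1 hab hac hbc ho1
  have oa := (ho1 a).2 (by simp)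
  have ob := (ho1 b).2 (by simp)
  have oc := (ho1 c).2 (by simp)
  have od := (ho2 d).2 (by simp)
  have oe := (ho2 e).2 (by simp)
  have aA := oa.2
  have bA := ob.2
  have cA := oc.2
  have dA := od.2
  have eA := oe.2
  have nb : ¬ G.Adj y₂ b := fun e => by
    have := (ho2 b).1 ⟨e, bA⟩
    grind
  have nc : ¬ G.Adj y₂ c := fun e => by
    have := (ho2 c).1 ⟨e, cA⟩
    grind
  have nd : ¬ G.Adj y₁ d := fun e => by
    have := (ho1 d).1 ⟨e, dA⟩
    grind
  have ne : ¬ G.Adj y₁ e := fun e => by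
    have := (ho1 _).1 ⟨e, eA⟩
    grind
  obtain ⟨-, -, g, k, hgk, hoc⟩ := h.duo_out hSt hA hx hy1 hab hac hbc ho1 nc
  obtain ⟨-, -, g', k', hgk', hob⟩ := h.duo_out hSt hA hx hy1 hac hab hbc.symm ho1' nb
  obtain ⟨hea, -⟩ := h.duo_out hSt hA2 hx hy2 had hae hde ho2 ne
  obtain ⟨hda, -⟩ := h.duo_out hSt hA2 hx hy2 hae had hde.symm ho2' nd
  have y2A : y₂ ∈ A := by simp [hA]
  have hsub : ∀ v, v ∈ A₀ → v ∈ A := fun v hv => by simp [hA, hv]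
  have two : ∀ u x y, x ≠ y → u ∈ insert a (insert b (insert c A)) → G.Adj u x → G.Adj u y →
      x ∉ insert a (insert b (insert c A)) → y ∉ insert a (insert b (insert c A)) →
      (G.neighborFinset u \ insert a (insert b (insert c A))).card = 2 :=
    fun u x y hxy hu hux huy hx hy => le_antisymm (h.card_out_le hS hu (by norm_num))
      (two_le_card_out hux hx huy hy hxy)
  refine h.not_frontier (A := insert a (insert b (insert c A))) (F := {y₂, a, b, c})
    ⟨hS, ?_, ?_, ?_⟩ ?_ ?_
  · grind
  · intro v hv
    have := hsub v
    grind
  · intro v w hv hv0 hvF hw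
    have := hx w
    have := ho1 w
    have := hA v
    grind
  · rw [Finset.card_insert_of_notMem (by grind), Finset.card_insert_of_notMem (by grind),
      Finset.card_pair hbc]
  · intro v hv
    simp only [Finset.mem_insert, Finset.mem_singleton] at hv
    rcases hv with rfl | rfl | rfl | rfl
    · exact two _ d e hde (by grind) od.1 oe.1 (by grind) (by grind)
    · exact two _ d e hde (by grind) hda.symm hea.symm (by grind) (by grind)
    · have h1 := (hob g').2 (by simp)
      have h2 := (hob k').2 (by simp)
      exact two _ g' k' hgk' (by grind) h1.1 h2.1 (by grind) (by grind)
    · have h1 := (hoc g).2 (by simp)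
      have h2 := (hoc k).2 (by simp)
      exact two _ g k hgk (by grind) h1.1 h2.1 (by grind) (by grind)

theorem duo_false (h : ThinGrowth G A₀ St) {A : Finset V} {x y₁ y₂ : V}
    (hSt : St A 3) (hA : ∀ v, v ∈ A ↔ v ∈ A₀ ∨ v = x ∨ v = y₁ ∨ v = y₂)
    (hx : ∀ w, G.Adj x w → w ∈ A) (hy1 : y₁ ∉ A₀) (hy2 : y₂ ∉ A₀) (hy : y₁ ≠ y₂)
    (ht1 : ∀ c ∈ A₀, ¬ G.Adj y₁ c) (ht2 : ∀ c ∈ A₀, ¬ G.Adj y₂ c) : False := by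
  have hcard : ∀ u u', u = y₁ ∧ u' = y₂ ∨ u = y₂ ∧ u' = y₁ →
      (G.neighborFinset u \ A).card = 3 := by
    intro u u' huu
    refine le_antisymm ?_ (h.three_le_out (p := x) (q := u') ?_)
    · by_contra hn
      exact h.contra 4 0 ∅ hSt (b := u) (by grind) (by omega) (by norm_num) (by simp) (by simp)
        (by simp) (by norm_num)
    · intro w hw hwA
      have := ht1 w
      have := ht2 w
      have := hw.ne
      have := hA w
      grind
  have c1 := hcard y₁ y₂ (by simp)
  have c2 := hcard y₂ y₁ (by simp)
  have m1 : ∀ w, w ∈ G.neighborFinset y₁ \ A ↔ (G.Adj y₁ w ∧ w ∉ A) := by simp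
  have m2 : ∀ w, w ∈ G.neighborFinset y₂ \ A ↔ (G.Adj y₂ w ∧ w ∉ A) := by simp
  have h12 := Finset.card_sdiff_add_card_inter (G.neighborFinset y₁ \ A) (G.neighborFinset y₂ \ A)
  have h21 := Finset.card_sdiff_add_card_inter (G.neighborFinset y₂ \ A) (G.neighborFinset y₁ \ A)
  rw [Finset.inter_comm] at h21
  set W₁ := G.neighborFinset y₁ \ A
  set W₂ := G.neighborFinset y₂ \ A
  have hle : (W₁ ∩ W₂).card ≤ 3 := by omega
  interval_cases hi : (W₁ ∩ W₂).card
  · obtain ⟨a, b, c, hab, hac, hbc, ho1⟩ := exists_triple_of_card_out c1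
    obtain ⟨hS, -⟩ := h.duo_state hSt (by simp [hA]) hy1 hab hac hbc ho1
    have hy2A : y₂ ∈ insert a (insert b (insert c A)) := by
      have := hA y₂
      grind
    have := h.card_out_le hS hy2A (by norm_num)
    have hss : W₂ ⊆ G.neighborFinset y₂ \ insert a (insert b (insert c A)) := by
      intro w hw
      have h0 : w ∉ W₁ ∩ W₂ := by rw [Finset.card_eq_zero.1 hi]; simp
      rw [Finset.mem_inter, m1, ho1] at h0
      have := (m2 w).1 hw
      rw [Finset.mem_sdiff, mem_neighborFinset]
      grind
    have := Finset.card_le_card hss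
    omega
  · obtain ⟨a, ha⟩ := Finset.card_eq_one.1 hi
    obtain ⟨b, c, hbc, h1⟩ := Finset.card_eq_two.1 (by omega : (W₁ \ W₂).card = 2)
    obtain ⟨d, e, hde, h2⟩ := Finset.card_eq_two.1 (by omega : (W₂ \ W₁).card = 2)
    simp only [Finset.ext_iff, Finset.mem_inter, Finset.mem_sdiff, Finset.mem_singleton,
      Finset.mem_insert] at ha h1 h2
    have ha' := (ha a).2 rfl
    have hb' := (h1 b).2 (by simp)
    have hc' := (h1 c).2 (by simp)
    have hd' := (h2 d).2 (by simp)
    have he' := (h2 e).2 (by simp)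
    refine h.duo_false_of_one hSt hA hx hy1 hy2 (a := a) (b := b) (c := c) (d := d) (e := e)
      ?_ ?_ hbc ?_ ?_ hde ?_ ?_ ?_ ?_ ?_ ?_
    any_goals rintro rfl; grind
    · intro w
      rw [← m1, ← h1, ← ha, ← and_or_left, and_iff_left (em _)]
    · intro w
      rw [← m2, ← h2, ← ha, and_comm (a := w ∈ W₁), ← and_or_left, and_iff_left (em _)]
  · obtain ⟨a, b, hab, ha⟩ := Finset.card_eq_two.1 hi
    obtain ⟨c, h1⟩ := Finset.card_eq_one.1 (by omega : (W₁ \ W₂).card = 1)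
    obtain ⟨d, h2⟩ := Finset.card_eq_one.1 (by omega : (W₂ \ W₁).card = 1)
    simp only [Finset.ext_iff, Finset.mem_inter, Finset.mem_sdiff, Finset.mem_singleton,
      Finset.mem_insert] at ha h1 h2
    have ha' := (ha a).2 (by simp)
    have hb' := (ha b).2 (by simp)
    have hc' := (h1 c).2 rfl
    have hd' := (h2 d).2 rfl
    refine h.duo_false_of_two hSt hA hx hy1 hy2 hy (a := a) (b := b) (c := c) (d := d) hab
      ?_ ?_ ?_ ?_ ?_ ?_ ?_
    any_goals rintro rfl; grind
    · intro w
      rw [← or_assoc, ← m1, ← ha, ← h1, ← and_or_left, and_iff_left (em _)]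
    · intro w
      rw [← or_assoc, ← m2, ← ha, and_comm (a := w ∈ W₁), ← h2, ← and_or_left, and_iff_left (em _)]
  · have hss : W₂ ⊆ W₁ := by
      rw [← Finset.sdiff_eq_empty_iff_subset, ← Finset.card_eq_zero]
      omega
    obtain ⟨u, hu⟩ := Finset.card_pos.1 (by omega : 0 < W₂.card)
    have hu' := (m2 u).1 hu
    refine h.contra 3 1 {y₂} hSt (b := y₁) (by simp [hA]) c1.ge (by norm_num) (by simpa using hy)
      ?_ (by simp) (by norm_num)
    simp only [Finset.mem_singleton, forall_eq]
    exact .of_mem (by simp [hA]) (fun w hw hwA => ((m1 w).1 (hss ((m2 w).2 ⟨hw, hwA⟩))).1) hu'.1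
      hu'.2

theorem pair_not_adj (h : ThinGrowth G A₀ St) {x y₁ y₂ : V} (hx : x ∉ A₀)
    (hSt : St (insert x A₀) 2) (hy : y₁ ≠ y₂)
    (ho : ∀ w, (G.Adj x w ∧ w ∉ insert x A₀) ↔ w = y₁ ∨ w = y₂) : ∀ c ∈ A₀, ¬ G.Adj y₂ c := by
  intro c hc hyc
  have o1 := (ho y₁).2 (by simp)
  have o2 := (ho y₂).2 (by simp)
  have sat : ∀ y, y = y₁ ∨ y = y₂ → ∀ v ∈ G.neighborFinset y ∩ A₀,
      NewlySaturated G (insert x A₀) x v := by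
    intro y hy v hv
    have hv' : G.Adj y v ∧ v ∈ A₀ := by simpa using hv
    have hoy := (ho y).2 hy
    refine .of_mem (by simp [hv'.2]) (fun w hw hwA => ?_) hv'.1.symm hoy.2
    have := h.single hv'.2 (x := y) (w := w) (by grind) (by grind) hv'.1.symm hw
    exact this ▸ hoy.1
  have k2 := h.two_le_card_inter (x := y₂) (by grind) hc hyc.symm
  by_cases ht : ∃ c' ∈ A₀, G.Adj y₁ c'
  · obtain ⟨c', hc', hyc'⟩ := ht
    have k1 := h.two_le_card_inter (x := y₁) (by grind) hc' hyc'.symm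
    refine h.contra_two ((G.neighborFinset y₁ ∩ A₀) ∪ (G.neighborFinset y₂ ∩ A₀)) hSt (by simp)
      hy o1.1 o1.2 o2.1 o2.2 (by simp [hx]) ?_ ?_
    · intro v hv
      rcases Finset.mem_union.1 hv with hv | hv
      · exact sat y₁ (by simp) v hv
      · exact sat y₂ (by simp) v hv
    · rw [Finset.card_union_of_disjoint]
      · push_cast
        omega
      · rw [Finset.disjoint_left]
        intro v h1 h2
        have h1' : G.Adj y₁ v ∧ v ∈ A₀ := by simpa using h1
        have h2' : G.Adj y₂ v ∧ v ∈ A₀ := by simpa using h2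
        exact hy (h.single h1'.2 (by grind) (by grind) h2'.1.symm h1'.1.symm)
  · push Not at ht
    have hS : St (insert y₁ (insert y₂ (insert x A₀))) 1 :=
      h.expand_two (G.neighborFinset y₂ ∩ A₀) hSt (by simp) hy ho (by simp [hx])
        (sat y₂ (by simp)) (by omega)
    refine h.false_of_covered hS (z := y₁) (p := x) (q := y₂) (by simp) (by norm_num) ?_
    intro w hw hwA
    have := ht w
    have := hw.ne
    grind

/-- No edge leaves `A₀`. -/
theorem not_adj (h : ThinGrowth G A₀ St) {x c : V} (hx : x ∉ A₀) (hc : c ∈ A₀) :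
    ¬ G.Adj c x := by
  intro hcx
  have hcases := h.card_cases hx hc hcx
  have hn1 := h.card_out_ne_one hx hc hcx
  have hn3 := h.card_out_ne_three hx hc hcx
  have hS0 := h.enter hx hc hcx
  have hd : (G.neighborFinset x \ insert x A₀).card = 2 := by
    rw [sdiff_insert_self]
    omega
  obtain ⟨y₁, y₂, hy, ho⟩ := exists_pair_of_card_out hd
  have ho' : ∀ w, (G.Adj x w ∧ w ∉ insert x A₀) ↔ w = y₂ ∨ w = y₁ := fun w => by rw [ho, or_comm]
  have hS2 : St (insert x A₀) 2 := h.mono hS0 (by omega)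
  have t2 := h.pair_not_adj hx hS2 hy ho
  have t1 := h.pair_not_adj hx hS2 hy.symm ho'
  have o1 := (ho y₁).2 (by simp)
  have o2 := (ho y₂).2 (by simp)
  by_cases hk : (G.neighborFinset x ∩ A₀).card = 4
  · have hS : St (insert y₁ (insert y₂ (insert x A₀))) 2 :=
      h.expand_two ∅ hS0 (by simp) hy ho (by simp) (by simp) (by simp [hk])
    refine h.false_of_covered hS (z := y₁) (p := x) (q := y₂) (by simp) le_rfl ?_
    intro w hw hwA
    have := t1 w
    have := hw.ne
    grind
  · have hS : St (insert y₁ (insert y₂ (insert x A₀))) 3 :=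
      h.expand_two ∅ hS2 (by simp) hy ho (by simp) (by simp) (by simp)
    refine h.duo_false hS (x := x) (y₁ := y₁) (y₂ := y₂) (by grind) ?_ (by grind) (by grind) hy t1
      t2
    intro w hw
    have := ho w
    grind

end ThinGrowth

end Extension

section Potential
variable {V : Type*} [Fintype V] [DecidableEq V] (G : SimpleGraph V) [DecidableRel G.Adj]

/-- The closed neighbourhood of a set of vertices. -/
def cover (D : Finset V) : Finset V :=
  D.biUnion fun v => insert v (G.neighborFinset v)

/-- The vertices whose closed neighbourhood lies in `A`. -/
def saturated (A : Finset V) : Finset V :=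
  {v ∈ A | ∀ w, G.Adj v w → w ∈ A}

/-- The potential that the dominating set maximises. -/
def potential (D : Finset V) : ℤ :=
  3 * (cover G D).card + (saturated G (cover G D)).card - 8 * D.card

/-- The sets that grow from `{v}` by repeatedly adding covered vertices. -/
inductive Grown (v : V) : Finset V → Prop
  | singleton : Grown v {v}
  | grow {D : Finset V} {b : V} : Grown v D → b ∈ cover G D → Grown v (insert b D)

variable {G}

theorem mem_cover {D : Finset V} {w : V} : w ∈ cover G D ↔ w ∈ D ∨ ∃ v ∈ D, G.Adj v w := by
  rw [cover, Finset.mem_biUnion]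
  simp only [Finset.mem_insert, mem_neighborFinset]
  constructor
  · rintro ⟨v, hv, rfl | hw⟩
    · exact Or.inl hv
    · exact Or.inr ⟨v, hv, hw⟩
  · rintro (hw | ⟨v, hv, hw⟩)
    · exact ⟨w, hw, Or.inl rfl⟩
    · exact ⟨v, hv, Or.inr hw⟩

theorem cover_insert {D : Finset V} {b : V} (hb : b ∈ cover G D) :
    cover G (insert b D) = cover G D ∪ G.neighborFinset b := by
  have : cover G (insert b D) = insert b (G.neighborFinset b) ∪ cover G D := Finset.biUnion_insert
  rw [this]
  ext w
  simp only [Finset.mem_union, Finset.mem_insert]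
  grind

theorem cover_mono {D E : Finset V} (h : D ⊆ E) : cover G D ⊆ cover G E :=
  Finset.biUnion_subset_biUnion_of_subset_left _ h

theorem potential_insert {D T : Finset V} {b : V} (hb : b ∈ cover G D)
    (hw : ∃ w, G.Adj b w ∧ w ∉ cover G D) (hbT : b ∉ T)
    (hT : ∀ v ∈ T, NewlySaturated G (cover G D) b v) :
    potential G D + 3 * (G.neighborFinset b \ cover G D).card + T.card - 7 ≤
      potential G (insert b D) := by
  have hcard : (cover G D ∪ G.neighborFinset b).card =
      (cover G D).card + (G.neighborFinset b \ cover G D).card := by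
    rw [← Finset.union_sdiff_self_eq_union, Finset.card_union_of_disjoint Finset.disjoint_sdiff]
  have hD : (insert b D).card ≤ D.card + 1 := Finset.card_insert_le b D
  have hsat : (saturated G (cover G D)).card + (T.card + 1) ≤
      (saturated G (cover G D ∪ G.neighborFinset b)).card := by
    rw [← Finset.card_insert_of_notMem hbT, ← Finset.card_union_of_disjoint]
    · apply Finset.card_le_card
      intro v hv
      simp only [saturated, Finset.mem_union, Finset.mem_filter, Finset.mem_insert,
        mem_neighborFinset] at hv ⊢
      rcases hv with hv | rfl | hv
      · exact ⟨Or.inl hv.1, fun w h => Or.inl (hv.2 w h)⟩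
      · exact ⟨Or.inl hb, fun w h => Or.inr h⟩
      · exact ⟨(hT v hv).1, (hT v hv).2.1⟩
    · rw [Finset.disjoint_left]
      intro v hv hv'
      simp only [saturated, Finset.mem_filter] at hv
      rcases Finset.mem_insert.1 hv' with rfl | hv'
      · obtain ⟨w, hw, hw'⟩ := hw
        exact hw' (hv.2 w hw)
      · obtain ⟨w, hw, hw'⟩ := (hT v hv').2.2 hv.1
        exact hw' (hv.2 w hw)
  rw [potential, potential, cover_insert hb, hcard]
  push_cast
  omega

theorem potential_singleton (v : V) : 3 * (G.degree v : ℤ) - 4 ≤ potential G {v} := by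
  have h1 : cover G {v} = insert v (G.neighborFinset v) := by simp [cover]
  have h2 : 0 < (saturated G (cover G {v})).card := by
    rw [Finset.card_pos]
    refine ⟨v, ?_⟩
    simp only [saturated, Finset.mem_filter, h1, Finset.mem_insert, mem_neighborFinset]
    exact ⟨Or.inl trivial, fun w h => Or.inr h⟩
  have h3 : (cover G {v}).card = G.degree v + 1 := by
    rw [h1, Finset.card_insert_of_notMem (by simp), card_neighborFinset_eq_degree]
  rw [potential, h3, Finset.card_singleton]
  push_cast
  omega

theorem growth_of_maximal {v : V} {D : Finset V} (hD : Grown G v D)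
    (hmax : ∀ E, Grown G v E → D ⊂ E → potential G E < potential G D) :
    Growth G (cover G D) fun A t => ∃ E, Grown G v E ∧ D ⊆ E ∧ cover G E = A ∧
      potential G D ≤ potential G E + t where
  base := ⟨D, hD, subset_rfl, rfl, by simp⟩
  expand := by
    rintro A t b T ⟨E, hE, hDE, rfl, ht⟩ hb hw hbT hT
    refine ⟨insert b E, hE.grow hb, hDE.trans (Finset.subset_insert _ _), cover_insert hb, ?_⟩
    have := potential_insert hb hw hbT hT
    omega
  pos := by
    rintro A t ⟨E, hE, hDE, rfl, ht⟩ hne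
    have := hmax E hE (hDE.ssubset_of_ne (by rintro rfl; exact hne rfl))
    omega
  mono := by
    rintro A t t' ⟨E, hE, hDE, hA, ht⟩ htt
    exact ⟨E, hE, hDE, hA, by omega⟩
  subset := by
    rintro A t ⟨E, hE, hDE, rfl, ht⟩
    exact cover_mono hDE

theorem exists_maximal (v : V) : ∃ D, Grown G v D ∧ potential G {v} ≤ potential G D ∧
    ∀ E, Grown G v E → D ⊂ E → potential G E < potential G D := by
  classical
  obtain ⟨D, hD, hmax⟩ := Finset.exists_max_image {D : Finset V | Grown G v D}
    (fun D => toLex (potential G D, D.card)) ⟨{v}, by simpa using Grown.singleton⟩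
  simp only [Finset.mem_filter, Finset.mem_univ, true_and, Prod.Lex.toLex_le_toLex] at hD hmax
  refine ⟨D, hD, ?_, fun E hE hDE => ?_⟩
  · rcases hmax _ Grown.singleton with h | h
    · exact h.le
    · exact h.1.le
  · rcases hmax E hE with h | h
    · exact h
    · exact absurd h.2 (by simpa using Finset.card_lt_card hDE)

theorem Grown.exists_walk {v : V} {D : Finset V} (hD : Grown G v D) :
    ∀ u ∈ D, ∃ p : G.Walk u v, ∀ x ∈ p.support, x ∈ D := by
  induction hD with
  | singleton =>
    intro u hu
    obtain rfl := Finset.mem_singleton.1 hu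
    exact ⟨.nil, by simp⟩
  | @grow D b _ hb ih =>
    intro u hu
    have key : ∀ u ∈ D, ∃ p : G.Walk u v, ∀ x ∈ p.support, x ∈ insert b D := fun u hu => by
      obtain ⟨p, hp⟩ := ih u hu
      exact ⟨p, fun x hx => Finset.mem_insert_of_mem (hp x hx)⟩
    rcases Finset.mem_insert.1 hu with rfl | hu
    · rcases mem_cover.1 hb with hb | ⟨a, ha, hau⟩
      · exact key u hb
      · obtain ⟨p, hp⟩ := key a ha
        refine ⟨.cons hau.symm p, fun x hx => ?_⟩
        rcases List.mem_cons.1 hx with rfl | hx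
        · simp
        · exact hp x hx
    · exact key u hu

theorem eq_univ_of_not_adj (hG : G.Connected) {A : Finset V} (hA : A.Nonempty)
    (h : ∀ c ∈ A, ∀ x ∉ A, ¬ G.Adj c x) : A = Finset.univ := by
  obtain ⟨a, ha⟩ := hA
  rw [Finset.eq_univ_iff_forall]
  intro w
  obtain ⟨p⟩ := hG a w
  induction p with
  | nil => exact ha
  | cons e _ ih => exact ih (by_contra fun hu => h _ ha _ hu e)

theorem exists_degree (hG : G.Connected) (hd : ∀ v, 5 ≤ G.degree v) :
    ∃ v, 6 ≤ G.degree v ∨ Even (Fintype.card V) := by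
  by_contra! hn
  have h5 : ∀ v, G.degree v = 5 := fun v => le_antisymm (by have := (hn v).1; omega) (hd v)
  have := G.sum_degrees_eq_twice_card_edges
  simp only [h5, Finset.sum_const, Finset.card_univ, smul_eq_mul] at this
  obtain ⟨v⟩ := hG.nonempty
  have := (hn v).2
  grind

theorem exists_dominating (hG : G.Connected) (hd : ∀ v, 5 ≤ G.degree v) :
    ∃ v D, Grown G v D ∧ cover G D = Finset.univ ∧ 2 * D.card + 4 ≤ Fintype.card V := by
  obtain ⟨v, hv⟩ := exists_degree hG hd
  obtain ⟨D, hD, hle, hmax⟩ := exists_maximal (G := G) v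
  have hthin := (growth_of_maximal hD hmax).thin
    fun v => by rw [card_neighborFinset_eq_degree]; exact hd v
  have hne : (cover G D).Nonempty := by
    have : D.Nonempty := by
      cases hD with
      | singleton => simp
      | grow => simp
    exact this.imp fun x hx => mem_cover.2 (Or.inl hx)
  have hcov : cover G D = Finset.univ :=
    eq_univ_of_not_adj hG hne fun c hc x hx => hthin.not_adj hx hc
  refine ⟨v, D, hD, hcov, ?_⟩
  have h1 := potential_singleton (G := G) v
  have h2 : potential G D = 4 * Fintype.card V - 8 * D.card := by
    rw [potential, hcov]
    simp [saturated]
    ring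
  have h3 := hd v
  rcases hv with hv | ⟨k, hk⟩ <;> omega

end Potential

section Coloring
variable {V : Type*} [Fintype V] {G : SimpleGraph V}

theorem bddAbove_colors : BddAbove {k : ℕ | ∃ c : V → ℕ, IsMVCColoring G c ∧
    (Set.range c).ncard = k} := by
  classical
  refine ⟨Fintype.card V, ?_⟩
  rintro _ ⟨c, -, rfl⟩
  rw [← Set.image_univ, ← Finset.coe_univ, ← Finset.coe_image, Set.ncard_coe_finset]
  exact Finset.card_image_le

theorem ne_of_mem_tail_dropLast {u w x : V} {p : G.Walk u w} (hp : p.IsPath)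
    (hx : x ∈ p.support.tail.dropLast) : x ≠ u ∧ x ≠ w := by
  have hn := hp.support_nodup
  have hu := p.cons_tail_support.symm
  have hl : p.support.getLast p.support_ne_nil = w := p.getLast_support
  have hx' := List.mem_of_mem_dropLast hx
  constructor
  · rintro rfl
    rw [hu] at hn
    exact (List.nodup_cons.1 hn).1 hx'
  · rintro rfl
    have hne : p.support.tail ≠ [] := List.ne_nil_of_mem hx'
    have hd := List.dropLast_append_getLast hne
    have hl' : p.support.tail.getLast hne = x := by
      rw [List.getLast_tail, hl]
    rw [hu, ← hd, hl'] at hn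
    have := (List.nodup_cons.1 hn).2
    rw [List.nodup_append] at this
    exact this.2.2 x hx x (by simp) rfl

/-- A connected dominating set and its complement give a colouring with one colour on the set and
distinct colours elsewhere. -/
theorem le_mvc_of_walks {D : Finset V} (hD : D.Nonempty)
    (h : ∀ u w, ∃ p : G.Walk u w, ∀ x ∈ p.support, x = u ∨ x = w ∨ x ∈ D) :
    Fintype.card V + 1 ≤ mvc G + D.card := by
  classical
  let e := Fintype.equivFin V
  let c : V → ℕ := fun u => if u ∈ D then 0 else e u + 1
  have hc : IsMVCColoring G c := by
    intro u w
    obtain ⟨p, hp⟩ := h u w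
    refine ⟨p.bypass, p.bypass_isPath, ?_⟩
    have key : ∀ x ∈ p.bypass.support.tail.dropLast, c x = 0 := by
      intro x hx
      have h1 := ne_of_mem_tail_dropLast p.bypass_isPath hx
      have h2 := hp x (p.support_bypass_subset_support (List.mem_of_mem_tail (List.mem_of_mem_dropLast hx)))
      have h3 : x ∈ D := by tauto
      simp [c, h3]
    intro x hx y hy
    rw [key x hx, key y hy]
  have hle : (Set.range c).ncard ≤ mvc G := le_csSup bddAbove_colors ⟨c, hc, rfl⟩
  have hcard : (insert 0 (Dᶜ.image fun u => (e u : ℕ) + 1)).card ≤ (Set.range c).ncard := by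
    rw [← Set.ncard_coe_finset]
    refine Set.ncard_le_ncard ?_ (Set.finite_range c)
    intro k hk
    simp only [Finset.coe_insert, Set.mem_insert_iff, Finset.mem_coe, Finset.mem_image,
      Finset.mem_compl] at hk
    rcases hk with rfl | ⟨u, hu, rfl⟩
    · obtain ⟨d, hd⟩ := hD
      exact ⟨d, by simp [c, hd]⟩
    · exact ⟨u, by simp [c, hu]⟩
  rw [Finset.card_insert_of_notMem (by simp), Finset.card_image_of_injective, Finset.card_compl]
    at hcard
  · have := Finset.card_le_univ D
    omega
  · intro a b hab
    have : (e a : ℕ) = e b := by simpa using hab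
    exact e.injective (Fin.ext this)

theorem le_mvc_of_grown [DecidableEq V] [DecidableRel G.Adj] {v : V} {D : Finset V}
    (hD : Grown G v D) (hcov : cover G D = Finset.univ) :
    Fintype.card V + 1 ≤ mvc G + D.card := by
  have hv : ∀ u, ∃ p : G.Walk u v, ∀ x ∈ p.support, x = u ∨ x ∈ D := by
    intro u
    rcases mem_cover.1 (hcov ▸ Finset.mem_univ u : u ∈ cover G D) with hu | ⟨a, ha, hau⟩
    · obtain ⟨p, hp⟩ := hD.exists_walk u hu
      exact ⟨p, fun x hx => Or.inr (hp x hx)⟩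
    · obtain ⟨p, hp⟩ := hD.exists_walk a ha
      refine ⟨.cons hau.symm p, fun x hx => ?_⟩
      rcases List.mem_cons.1 hx with rfl | hx
      · exact Or.inl rfl
      · exact Or.inr (hp x hx)
  have hne : D.Nonempty := by
    cases hD with
    | singleton => simp
    | grow => simp
  refine le_mvc_of_walks hne fun u w => ?_
  obtain ⟨p, hp⟩ := hv u
  obtain ⟨q, hq⟩ := hv w
  refine ⟨p.append q.reverse, fun x hx => ?_⟩
  rw [Walk.mem_support_append_iff, Walk.support_reverse, List.mem_reverse] at hx
  have := hp x
  have := hq x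
  tauto

end Coloring
end MVC

theorem stmt_2 {V : Type*} [Fintype V] (G : SimpleGraph V) [DecidableRel G.Adj]
    (hG : G.Connected) (hδ : 5 ≤ G.minDegree) :
    (Fintype.card V : ℝ) / 2 + 3 ≤ (mvc G : ℝ) := by
  classical
  obtain ⟨v, D, hD, hcov, hcard⟩ :=
    MVC.exists_dominating hG fun v => hδ.trans (G.minDegree_le_degree v)
  have h1 := MVC.le_mvc_of_grown hD hcov
  have h2 : Fintype.card V + 6 ≤ 2 * mvc G := by omega
  have h3 : (Fintype.card V : ℝ) + 6 ≤ 2 * mvc G := by exact_mod_cast h2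
  linarith
end
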